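/- arXiv:1705.08823 — 3 statements merged into one kernel-verified Lean document; each statement's English description precedes it below -/
import Mathlib

section
/- Let M₀ > 0 be fixed. Then for every M > M₀ there exists a time r = r(M₀,M) > 0 such that for every (φ,τ₀) ∈ Lip_α × C_+(Ω) with ‖φ‖_{Lip_α} + ‖τ₀‖_∞ ≤ M₀, system (1.1) with initial distribution (φ,τ₀) admits a unique solution (A,τ) ∈ C((−∞,r],C(Ω)) × C([0,r],C(Ω)), and this solution satisfies ‖A(t,·)‖_∞ ≤ M for all t ∈ [0,r]. -/
open scoped NNReal
open MeasureTheory intervalIntegral Set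

/-- The weighted history `φ_α(t) = e^{−α|t|} φ(t)`. -/
noncomputable def weightedHist {Ω : Type*} [TopologicalSpace Ω]
    (α : ℝ) (φ : ℝ → C(Ω, ℝ)) : ℝ → C(Ω, ℝ) :=
  fun t => Real.exp (-(α * |t|)) • φ t

/-- Membership in `Lip_α`: `φ_α` is bounded and Lipschitz from `(−∞,0]` to `C(Ω)`. -/
def MemLipAlpha {Ω : Type*} [TopologicalSpace Ω] [CompactSpace Ω]
    (α : ℝ) (φ : ℝ → C(Ω, ℝ)) : Prop :=
  ContinuousOn φ (Set.Iic 0) ∧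
  (∃ C : ℝ, ∀ t ≤ (0 : ℝ), ‖weightedHist α φ t‖ ≤ C) ∧
  (∃ L : ℝ≥0, LipschitzOnWith L (weightedHist α φ) (Set.Iic 0))

/-- The norm of `Lip_α`: `‖φ_α‖_∞ + ‖φ_α‖_{Lip}`. -/
noncomputable def lipAlphaNorm {Ω : Type*} [TopologicalSpace Ω] [CompactSpace Ω]
    (α : ℝ) (φ : ℝ → C(Ω, ℝ)) : ℝ :=
  sSup {c : ℝ | ∃ t ≤ (0 : ℝ), c = ‖weightedHist α φ t‖} +
  sSup {c : ℝ | ∃ t ≤ (0 : ℝ), ∃ s ≤ (0 : ℝ), t ≠ s ∧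
    c = ‖weightedHist α φ t - weightedHist α φ s‖ / |t - s|}

/-- `F : C(Ω)² × C(Ω×Ω) → C(Ω)` is Lipschitz continuous on bounded sets. -/
def LipschitzOnBoundedSets {Ω : Type*} [TopologicalSpace Ω] [CompactSpace Ω]
    (F : C(Ω, ℝ) → C(Ω, ℝ) → C(Ω × Ω, ℝ) → C(Ω, ℝ)) : Prop :=
  ∀ M : ℝ, 0 < M → ∃ L : ℝ, 0 < L ∧
    ∀ u v : C(Ω, ℝ), ∀ w : C(Ω × Ω, ℝ), ∀ u' v' : C(Ω, ℝ), ∀ w' : C(Ω × Ω, ℝ),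
      ‖u‖ ≤ M → ‖v‖ ≤ M → ‖w‖ ≤ M → ‖u'‖ ≤ M → ‖v'‖ ≤ M → ‖w'‖ ≤ M →
      ‖F u v w - F u' v' w'‖ ≤ L * (‖u - u'‖ + ‖v - v'‖ + ‖w - w'‖)

/-- A solution of system (1.1) on [0,r] with initial distribution (φ,τ₀):
a pair of continuous maps `A : (−∞,r] → C(Ω)` and `τ : [0,r] → C₊(Ω)` such that
`A = φ` on `(−∞,0]`, `A(t,x) = φ(0,x) + ∫₀ᵗ F(A(l,·), τ(l,·), A(l−τ(l))(·,·))(x) dl`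
for `t ∈ [0,r]` (where `A(l−τ(l))(x,y) = A(l−τ(l,x),y)`), and
`∫_{t−τ(t,x)}^{t} f(A(s,·))(x) ds = ∫_{−τ₀(x)}^{0} f(φ(s,·))(x) ds` on `[0,r]`. -/
def IsSolutionOn {Ω : Type*} [TopologicalSpace Ω] [CompactSpace Ω]
    (F : C(Ω, ℝ) → C(Ω, ℝ) → C(Ω × Ω, ℝ) → C(Ω, ℝ))
    (f : C(Ω, ℝ) → C(Ω, ℝ))
    (φ : ℝ → C(Ω, ℝ)) (τ₀ : C(Ω, ℝ)) (r : ℝ)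
    (A : ℝ → C(Ω, ℝ)) (τ : ℝ → C(Ω, ℝ)) : Prop :=
  ContinuousOn A (Set.Iic r) ∧
  ContinuousOn τ (Set.Icc 0 r) ∧
  (∀ t ∈ Set.Icc (0 : ℝ) r, ∀ x : Ω, 0 ≤ τ t x) ∧
  (∀ t ≤ (0 : ℝ), A t = φ t) ∧
  (∃ w : ℝ → C(Ω × Ω, ℝ),
    (∀ l ∈ Set.Icc (0 : ℝ) r, ∀ x y : Ω, w l (x, y) = A (l - τ l x) y) ∧
    (∀ t ∈ Set.Icc (0 : ℝ) r, ∀ x : Ω,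
      A t x = φ 0 x + ∫ l in (0 : ℝ)..t, F (A l) (τ l) (w l) x)) ∧
  (∀ t ∈ Set.Icc (0 : ℝ) r, ∀ x : Ω,
    (∫ s in (t - τ t x)..t, f (A s) x) = ∫ s in (-(τ₀ x))..(0 : ℝ), f (φ s) x)

section DelaySystem

open Filter Topology

variable {X : Type*} [TopologicalSpace X]

/-- Prolongation of the history `φ` by a curve `a` on `[0, r]` starting at `φ 0`, constant
after time `r`. -/
noncomputable def prolong (φ : ℝ → C(X, ℝ)) {r : ℝ} (hr : 0 ≤ r) (a : C(Icc (0 : ℝ) r, C(X, ℝ))) (t : ℝ) :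
    C(X, ℝ) :=
  φ (min t 0) + (a (projIcc 0 r hr t) - φ 0)

section

variable {φ : ℝ → C(X, ℝ)} {r : ℝ} {hr : 0 ≤ r} {a : C(Icc (0 : ℝ) r, C(X, ℝ))}

theorem continuous_prolong (hφ : ContinuousOn φ (Iic 0)) : Continuous (prolong φ hr a) := by
  have h : Continuous fun t : ℝ => φ (min t 0) :=
    hφ.comp_continuous (by fun_prop) fun t => min_le_right t 0
  exact h.add ((a.continuous.comp continuous_projIcc).sub continuous_const)

theorem prolong_of_nonpos (ha : a ⟨0, left_mem_Icc.2 hr⟩ = φ 0) {t : ℝ} (ht : t ≤ 0) :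
    prolong φ hr a t = φ t := by
  simp [prolong, min_eq_left ht, projIcc_of_le_left hr ht, ha]

theorem prolong_of_mem {t : ℝ} (ht : t ∈ Icc 0 r) : prolong φ hr a t = a ⟨t, ht⟩ := by
  simp [prolong, min_eq_right ht.1, projIcc_of_mem hr ht]

end

theorem eq_exp_smul_weightedHist (α : ℝ) (φ : ℝ → C(X, ℝ)) (t : ℝ) :
    φ t = Real.exp (α * |t|) • weightedHist α φ t := by
  rw [weightedHist, smul_smul, ← Real.exp_add, add_neg_cancel, Real.exp_zero, one_smul]

variable [CompactSpace X]

/-- The zero of a strictly increasing function depends continuously on parameters. -/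
theorem continuous_of_strictMono_zero {Y : Type*} [TopologicalSpace Y] {H : Y → ℝ → ℝ}
    {θ : Y → ℝ} (hH : ∀ s, Continuous fun y => H y s) (hmono : ∀ y, StrictMono (H y))
    (hθ : ∀ y, H y (θ y) = 0) : Continuous θ := by
  refine continuous_iff_continuousAt.2 fun y₀ => tendsto_order.2 ⟨fun a ha => ?_, fun b hb => ?_⟩
  · have h : H y₀ a < 0 := hθ y₀ ▸ hmono y₀ ha
    filter_upwards [(hH a).continuousAt.eventually_lt_const h] with y hy
    exact (hmono y).lt_iff_lt.1 ((hθ y).symm ▸ hy)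
  · have h : 0 < H y₀ b := hθ y₀ ▸ hmono y₀ hb
    filter_upwards [(hH b).continuousAt.eventually_const_lt h] with y hy
    exact (hmono y).lt_iff_lt.1 ((hθ y).symm ▸ hy)

theorem strictMono_integral_of_pos {g : ℝ → ℝ} (hg : Continuous g) (hpos : ∀ s, 0 < g s) (a : ℝ) :
    StrictMono fun t => ∫ s in a..t, g s := by
  intro t t' htt'
  have h := intervalIntegral_pos_of_pos (hg.intervalIntegrable t t') hpos htt'
  have h' := integral_interval_sub_left (μ := volume) (hg.intervalIntegrable a t')
    (hg.intervalIntegrable a t)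
  dsimp only
  linarith

theorem eq_of_integral_eq_of_pos {g : ℝ → ℝ} (hg : Continuous g) (hpos : ∀ s, 0 < g s)
    {a b t : ℝ} (h : ∫ s in a..t, g s = ∫ s in b..t, g s) : a = b := by
  refine (strictMono_integral_of_pos hg hpos t).injective ?_
  simp only [integral_symm _ t] at h ⊢
  simpa [integral_symm t] using h

theorem ContinuousMap.intervalIntegral_apply {V : ℝ → C(X, ℝ)} (hV : Continuous V) (a b : ℝ)
    (x : X) : (∫ s in a..b, V s) x = ∫ s in a..b, V s x :=
  ((ContinuousMap.evalCLM ℝ x).intervalIntegral_comp_comm (hV.intervalIntegrable a b)).symm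

/-- `σ` is the delay at time `t` determined by the threshold condition with rate `g` and initial
delay `τ₀`. -/
def IsThresholdDelay (g : ℝ → C(X, ℝ)) (τ₀ : C(X, ℝ)) (t : ℝ) (σ : C(X, ℝ)) : Prop :=
  ∀ x, 0 ≤ σ x ∧ σ x ≤ t + τ₀ x ∧
    ∫ s in (t - σ x)..t, g s x = ∫ s in (-(τ₀ x))..0, g s x

/-- The threshold condition determines a continuous delay on `[0, ∞)`. -/
theorem exists_continuous_delay {g : ℝ → C(X, ℝ)} (hg : Continuous g)
    (hpos : ∀ s x, 0 < g s x) {τ₀ : C(X, ℝ)} (hτ₀ : ∀ x, 0 ≤ τ₀ x) :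
    ∃ τ : ℝ → C(X, ℝ), Continuous τ ∧ ∀ t, 0 ≤ t → IsThresholdDelay g τ₀ t (τ t) := by
  have hgx : ∀ x, Continuous fun s => g s x := fun x => by fun_prop
  set G : ℝ → C(X, ℝ) := fun t => ∫ s in (0 : ℝ)..t, g s with hG
  have hGc : Continuous G := continuous_primitive (fun a b => hg.intervalIntegrable a b) 0
  have hGx : ∀ t x, G t x = ∫ s in (0 : ℝ)..t, g s x := fun t x =>
    ContinuousMap.intervalIntegral_apply hg 0 t x
  have hGsub : ∀ a b x, ∫ s in a..b, g s x = G b x - G a x := fun a b x => by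
    rw [hGx, hGx, integral_interval_sub_left ((hgx x).intervalIntegrable _ _)
      ((hgx x).intervalIntegrable _ _)]
  have hG0 : ∀ x, G 0 x = 0 := fun x => by simp [hGx]
  have hmono : ∀ x, StrictMono fun t => G t x := fun x => by
    simpa only [hGx] using strictMono_integral_of_pos (hgx x) (hpos · x) 0
  have hex : ∀ p : ℝ × X, ∃ θ ∈ Icc (-(τ₀ p.2)) (max p.1 0),
      G θ p.2 = G (max p.1 0) p.2 + G (-(τ₀ p.2)) p.2 := by
    intro p
    have hτp := hτ₀ p.2
    refine intermediate_value_Icc (f := fun s => G s p.2)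
      (by linarith [le_max_right p.1 0]) (by fun_prop) ⟨?_, ?_⟩
    · have := (hmono p.2).monotone (le_max_right p.1 0)
      simp only [hG0] at this
      linarith
    · have := (hmono p.2).monotone (neg_nonpos.2 hτp)
      simp only [hG0] at this
      linarith
  choose θ hθmem hθ using hex
  have hθc : Continuous θ :=
    continuous_of_strictMono_zero
      (H := fun p s => G s p.2 - (G (max p.1 0) p.2 + G (-(τ₀ p.2)) p.2))
      (fun s => by fun_prop) (fun p s s' h => sub_lt_sub_right (hmono p.2 h) _)
      (fun p => by rw [hθ, sub_self])
  refine ⟨fun t => ⟨fun x => t - θ (t, x), by fun_prop⟩,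
    ContinuousMap.continuous_of_continuous_uncurry _ ?_, fun t ht x => ?_⟩
  · simp only [Function.uncurry_def, ContinuousMap.coe_mk]
    fun_prop
  · have h1 := hθmem (t, x)
    have h2 := hθ (t, x)
    simp only [max_eq_left ht, mem_Icc] at h1 h2
    simp only [ContinuousMap.coe_mk, sub_sub_cancel, hGsub, hG0]
    exact ⟨by linarith, by linarith, by linarith⟩

theorem mul_abs_sub_le_abs_integral {g : ℝ → ℝ} (hg : Continuous g) {m c a b : ℝ}
    (hm : ∀ s, c ≤ s → m ≤ g s) (ha : c ≤ a) (hb : c ≤ b) :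
    m * |a - b| ≤ |∫ s in a..b, g s| := by
  wlog hab : a ≤ b generalizing a b
  · rw [integral_symm, abs_neg, abs_sub_comm]
    exact this hb ha (le_of_not_ge hab)
  have h := integral_mono_on hab (intervalIntegrable_const (μ := volume) (c := m))
    (hg.intervalIntegrable a b)
    fun s hs => hm s (ha.trans hs.1)
  rw [intervalIntegral.integral_const, smul_eq_mul] at h
  rw [abs_sub_comm, abs_of_nonneg (sub_nonneg.2 hab), mul_comm]
  exact h.trans (le_abs_self _)

/-- Lipschitz dependence of the lower end of the threshold interval on the integrand. -/
theorem mul_abs_threshold_sub_le {g g' : ℝ → ℝ} (hg : Continuous g) (hg' : Continuous g')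
    {m δ T σ t θ θ' : ℝ} (hm : ∀ s, -T ≤ s → m ≤ g s) (hδ : ∀ s, |g s - g' s| ≤ δ)
    (hσ : 0 ≤ σ) (hσT : σ ≤ T) (ht : t ≤ 1)
    (hθ : -T ≤ θ) (hθ' : -T ≤ θ') (hθt' : θ' ≤ t)
    (h : ∫ s in θ..t, g s = ∫ s in (-σ)..0, g s)
    (h' : ∫ s in θ'..t, g' s = ∫ s in (-σ)..0, g' s) :
    m * |θ - θ'| ≤ δ * (2 * T + 1) := by
  have hi : ∀ a b, IntervalIntegrable g volume a b := hg.intervalIntegrable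
  have hi' : ∀ a b, IntervalIntegrable g' volume a b := hg'.intervalIntegrable
  have hδ0 : 0 ≤ δ := (abs_nonneg _).trans (hδ 0)
  have key : ∫ s in θ..θ', g s =
      (∫ s in (-σ)..0, (g s - g' s)) - ∫ s in θ'..t, (g s - g' s) := by
    rw [integral_sub (hi _ _) (hi' _ _), integral_sub (hi _ _) (hi' _ _), ← h, ← h',
      ← integral_add_adjacent_intervals (hi θ θ') (hi θ' t)]
    ring
  have e1 : |∫ s in (-σ)..0, (g s - g' s)| ≤ δ * T := by
    have := norm_integral_le_of_norm_le_const (a := -σ) (b := 0) (C := δ)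
      (f := fun s => g s - g' s) fun s _ => hδ s
    rw [sub_neg_eq_add, zero_add, abs_of_nonneg hσ] at this
    exact this.trans (by gcongr)
  have e2 : |∫ s in θ'..t, (g s - g' s)| ≤ δ * (T + 1) := by
    have := norm_integral_le_of_norm_le_const (a := θ') (b := t) (C := δ)
      (f := fun s => g s - g' s) fun s _ => hδ s
    rw [abs_of_nonneg (sub_nonneg.2 hθt')] at this
    exact this.trans (by gcongr; linarith)
  have e3 := mul_abs_sub_le_abs_integral hg hm hθ hθ'
  rw [key] at e3
  have e4 := abs_sub (∫ s in (-σ)..0, (g s - g' s)) (∫ s in θ'..t, (g s - g' s))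
  linarith

/-- The delayed state `(x, y) ↦ A(l − σ(x), y)`. -/
def delayedState {A : ℝ → C(X, ℝ)} (hA : Continuous A) (σ : C(X, ℝ)) (l : ℝ) : C(X × X, ℝ) :=
  ⟨fun p => A (l - σ p.1) p.2, by fun_prop⟩

theorem continuous_delayedState {A τ : ℝ → C(X, ℝ)} (hA : Continuous A) (hτ : Continuous τ) :
    Continuous fun l => delayedState hA (τ l) l := by
  refine ContinuousMap.continuous_of_continuous_uncurry _ ?_
  simp only [Function.uncurry_def, delayedState, ContinuousMap.coe_mk]
  fun_prop

theorem LipschitzOnBoundedSets.continuous_comp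
    {F : C(X, ℝ) → C(X, ℝ) → C(X × X, ℝ) → C(X, ℝ)} (hF : LipschitzOnBoundedSets F)
    {u v : ℝ → C(X, ℝ)} {w : ℝ → C(X × X, ℝ)} (hu : Continuous u) (hv : Continuous v)
    (hw : Continuous w) : Continuous fun l => F (u l) (v l) (w l) := by
  refine continuous_iff_continuousAt.2 fun l₀ => ?_
  set Q := ‖u l₀‖ + ‖v l₀‖ + ‖w l₀‖ + 1 with hQ
  have hu0 := norm_nonneg (u l₀)
  have hv0 := norm_nonneg (v l₀)
  have hw0 := norm_nonneg (w l₀)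
  obtain ⟨L, -, hL⟩ := hF Q (by positivity)
  have hlim : Tendsto (fun l => L * (‖u l - u l₀‖ + ‖v l - v l₀‖ + ‖w l - w l₀‖)) (𝓝 l₀) (𝓝 0) := by
    have : Continuous fun l => L * (‖u l - u l₀‖ + ‖v l - v l₀‖ + ‖w l - w l₀‖) := by fun_prop
    simpa using this.tendsto l₀
  refine tendsto_iff_norm_sub_tendsto_zero.2
    (squeeze_zero' (Eventually.of_forall fun _ => norm_nonneg _) ?_ hlim)
  filter_upwards [hu.norm.continuousAt.eventually_le_const (show ‖u l₀‖ < Q by linarith),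
    hv.norm.continuousAt.eventually_le_const (show ‖v l₀‖ < Q by linarith),
    hw.norm.continuousAt.eventually_le_const (show ‖w l₀‖ < Q by linarith)] with l h1 h2 h3
  exact hL _ _ _ _ _ _ h1 h2 h3 (by linarith) (by linarith) (by linarith)

theorem exists_pos_le_apply (u : C(X, ℝ)) (hu : ∀ x, 0 < u x) : ∃ m, 0 < m ∧ ∀ x, m ≤ u x := by
  rcases isEmpty_or_nonempty X with h | h
  · exact ⟨1, one_pos, fun x => h.elim x⟩
  · obtain ⟨x₀, -, hx₀⟩ := isCompact_univ.exists_isMinOn univ_nonempty u.continuous.continuousOn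
    exact ⟨u x₀, hu x₀, fun x => hx₀ (mem_univ x)⟩

section Prolong

variable {φ : ℝ → C(X, ℝ)} {r : ℝ} {hr : 0 ≤ r} {a b : C(Icc (0 : ℝ) r, C(X, ℝ))}

theorem norm_prolong_sub_prolong_le (t : ℝ) :
    ‖prolong φ hr a t - prolong φ hr b t‖ ≤ dist a b := by
  simp only [prolong, add_sub_add_left_eq_sub, sub_sub_sub_cancel_right, ← dist_eq_norm]
  exact ContinuousMap.dist_apply_le_dist _

theorem norm_prolong_sub_le {T K B : ℝ} (hT : 0 ≤ T)
    (hK : ∀ t ∈ Icc (-T) 0, ∀ s ∈ Icc (-T) 0, ‖φ t - φ s‖ ≤ K * |t - s|)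
    (hK0 : 0 ≤ K) (hB0 : 0 ≤ B)
    (hB : ∀ t s : Icc (0 : ℝ) r, ‖a t - a s‖ ≤ B * |(t : ℝ) - s|)
    {t s : ℝ} (ht : -T ≤ t) (hs : -T ≤ s) :
    ‖prolong φ hr a t - prolong φ hr a s‖ ≤ (K + B) * |t - s| := by
  have h1 := hK (min t 0) ⟨le_min ht (by linarith), min_le_right _ _⟩
    (min s 0) ⟨le_min hs (by linarith), min_le_right _ _⟩
  have h2 := hB (projIcc 0 r hr t) (projIcc 0 r hr s)
  have h3 : |min t 0 - min s 0| ≤ |t - s| := by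
    simpa using abs_min_sub_min_le_max t 0 s 0
  have h4 : |(projIcc 0 r hr t : ℝ) - projIcc 0 r hr s| ≤ |t - s| := abs_projIcc_sub_projIcc hr
  have e : prolong φ hr a t - prolong φ hr a s = (φ (min t 0) - φ (min s 0)) +
      (a (projIcc 0 r hr t) - a (projIcc 0 r hr s)) := by
    simp only [prolong]; abel
  rw [e, add_mul]
  exact (norm_add_le _ _).trans
    (add_le_add (h1.trans (by gcongr)) (h2.trans (by gcongr)))

end Prolong

theorem norm_prolong_le {φ : ℝ → C(X, ℝ)} {r : ℝ} {hr : 0 ≤ r} {a : C(Icc (0 : ℝ) r, C(X, ℝ))}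
    {T P M M₀ s : ℝ} (hT : 0 ≤ T) (hP : ∀ t ∈ Icc (-T) 0, ‖φ t‖ ≤ P) (hM₀ : ‖φ 0‖ ≤ M₀)
    (hs : -T ≤ s) (ha : ‖a (projIcc 0 r hr s)‖ ≤ M) : ‖prolong φ hr a s‖ ≤ P + M + M₀ := by
  have h1 := hP (min s 0) ⟨le_min hs (by linarith), min_le_right _ _⟩
  have h2 := norm_add_le (φ (min s 0)) (a (projIcc 0 r hr s) - φ 0)
  have h3 := norm_sub_le (a (projIcc 0 r hr s)) (φ 0)
  simp only [prolong]
  linarith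

/-- The right-hand side `F(A(l), τ(l), A(l − τ(l)))`. -/
def delayField (F : C(X, ℝ) → C(X, ℝ) → C(X × X, ℝ) → C(X, ℝ)) {A : ℝ → C(X, ℝ)}
    (hA : Continuous A) (τ : ℝ → C(X, ℝ)) (l : ℝ) : C(X, ℝ) :=
  F (A l) (τ l) (delayedState hA (τ l) l)

section Estimates

variable {F : C(X, ℝ) → C(X, ℝ) → C(X × X, ℝ) → C(X, ℝ)} {L Q T : ℝ} {τ₀ : C(X, ℝ)}

theorem continuous_delayField (hF : LipschitzOnBoundedSets F) {A τ : ℝ → C(X, ℝ)}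
    (hA : Continuous A) (hτ : Continuous τ) : Continuous (delayField F hA τ) :=
  hF.continuous_comp hA hτ (continuous_delayedState hA hτ)

theorem IsThresholdDelay.norm_le {g : ℝ → C(X, ℝ)} {t : ℝ} {σ : C(X, ℝ)}
    (h : IsThresholdDelay g τ₀ t σ) (ht : t ≤ 1) (hT : ∀ x, τ₀ x ≤ T) (hQ : 0 ≤ Q)
    (hTQ : T + 1 ≤ Q) : ‖σ‖ ≤ Q := by
  refine (ContinuousMap.norm_le _ hQ).2 fun x => ?_
  obtain ⟨h1, h2, -⟩ := h x
  rw [Real.norm_of_nonneg h1]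
  linarith [hT x]

theorem norm_delayedState_le {A : ℝ → C(X, ℝ)} (hA : Continuous A) {σ : C(X, ℝ)} {t : ℝ}
    (hQ : 0 ≤ Q) (h : ∀ x, ‖A (t - σ x)‖ ≤ Q) : ‖delayedState hA σ t‖ ≤ Q :=
  (ContinuousMap.norm_le _ hQ).2 fun p => ((A (t - σ p.1)).norm_coe_le_norm p.2).trans (h p.1)

theorem norm_delayField_le (hL0 : 0 ≤ L)
    (hL : ∀ u v : C(X, ℝ), ∀ w : C(X × X, ℝ), ∀ u' v' : C(X, ℝ), ∀ w' : C(X × X, ℝ),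
      ‖u‖ ≤ Q → ‖v‖ ≤ Q → ‖w‖ ≤ Q → ‖u'‖ ≤ Q → ‖v'‖ ≤ Q → ‖w'‖ ≤ Q →
      ‖F u v w - F u' v' w'‖ ≤ L * (‖u - u'‖ + ‖v - v'‖ + ‖w - w'‖))
    {g A τ : ℝ → C(X, ℝ)} {t : ℝ} (hA : Continuous A) (hτ : IsThresholdDelay g τ₀ t (τ t))
    (ht0 : 0 ≤ t) (ht : t ≤ 1) (hτ₀ : ∀ x, τ₀ x ≤ T) (hT : 0 ≤ T) (hTQ : T + 1 ≤ Q)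
    (hAQ : ∀ s ∈ Icc (-T) t, ‖A s‖ ≤ Q) :
    ‖delayField F hA τ t‖ ≤ ‖F 0 0 0‖ + L * (3 * Q) := by
  have hQ : 0 ≤ Q := by linarith
  have h1 : ‖A t‖ ≤ Q := hAQ t ⟨by linarith, le_rfl⟩
  have h2 : ‖τ t‖ ≤ Q := hτ.norm_le ht hτ₀ hQ hTQ
  have h3 : ‖delayedState hA (τ t) t‖ ≤ Q := norm_delayedState_le hA hQ fun x => by
    obtain ⟨e1, e2, -⟩ := hτ x
    exact hAQ _ ⟨by linarith [hτ₀ x], by linarith⟩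
  have h4 := hL (A t) (τ t) (delayedState hA (τ t) t) 0 0 0 h1 h2 h3 (by simpa) (by simpa)
    (by simpa)
  have h5 := norm_le_norm_add_norm_sub' (delayField F hA τ t) (F 0 0 0)
  simp only [sub_zero] at h4
  refine h5.trans (add_le_add le_rfl (h4.trans ?_))
  gcongr
  linarith

theorem norm_delayField_sub_le (hL0 : 0 ≤ L)
    (hL : ∀ u v : C(X, ℝ), ∀ w : C(X × X, ℝ), ∀ u' v' : C(X, ℝ), ∀ w' : C(X × X, ℝ),
      ‖u‖ ≤ Q → ‖v‖ ≤ Q → ‖w‖ ≤ Q → ‖u'‖ ≤ Q → ‖v'‖ ≤ Q → ‖w'‖ ≤ Q →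
      ‖F u v w - F u' v' w'‖ ≤ L * (‖u - u'‖ + ‖v - v'‖ + ‖w - w'‖))
    {f : C(X, ℝ) → C(X, ℝ)} {Kf : ℝ≥0} (hf : LipschitzWith Kf f)
    {A A' τ τ' : ℝ → C(X, ℝ)} {t m d K : ℝ} (hA : Continuous A) (hA' : Continuous A')
    (hτ : IsThresholdDelay (fun s => f (A s)) τ₀ t (τ t))
    (hτ' : IsThresholdDelay (fun s => f (A' s)) τ₀ t (τ' t))
    (ht0 : 0 ≤ t) (ht : t ≤ 1) (hτ₀0 : ∀ x, 0 ≤ τ₀ x) (hτ₀ : ∀ x, τ₀ x ≤ T) (hT : 0 ≤ T)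
    (hTQ : T + 1 ≤ Q) (hAQ : ∀ s, -T ≤ s → ‖A s‖ ≤ Q) (hAQ' : ∀ s, -T ≤ s → ‖A' s‖ ≤ Q)
    (hm0 : 0 < m) (hm : ∀ s, -T ≤ s → ∀ x, m ≤ f (A s) x) (hd0 : 0 ≤ d)
    (hd : ∀ s, ‖A s - A' s‖ ≤ d) (hK0 : 0 ≤ K)
    (hK : ∀ s s', -T ≤ s → -T ≤ s' → ‖A s - A s'‖ ≤ K * |s - s'|) :
    ‖delayField F hA τ t - delayField F hA' τ' t‖ ≤
      L * (2 + (1 + K) * (Kf * (2 * T + 1) / m)) * d := by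
  have hQ : 0 ≤ Q := by linarith
  have hwin : ∀ x, -T ≤ t - τ t x := fun x => by
    obtain ⟨-, e2, -⟩ := hτ x
    linarith [hτ₀ x]
  have hwin' : ∀ x, -T ≤ t - τ' t x := fun x => by
    obtain ⟨-, e2, -⟩ := hτ' x
    linarith [hτ₀ x]
  have hfc := hf.continuous
  set C := Kf * (2 * T + 1) / m with hC
  have hτsub : ∀ x, |τ t x - τ' t x| ≤ C * d := fun x => by
    have h := mul_abs_threshold_sub_le (g := fun s => f (A s) x) (g' := fun s => f (A' s) x)
      (δ := Kf * d) (by fun_prop) (by fun_prop) (fun s hs => hm s hs x) (fun s => ?_)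
      (hτ₀0 x) (hτ₀ x) ht (hwin x) (hwin' x) (by linarith [(hτ' x).1]) (hτ x).2.2 (hτ' x).2.2
    · have e : t - τ t x - (t - τ' t x) = -(τ t x - τ' t x) := by ring
      rw [e, abs_neg] at h
      rw [hC, div_mul_eq_mul_div, le_div_iff₀ hm0]
      linarith
    · have h1 := (f (A s) - f (A' s)).norm_coe_le_norm x
      have h2 := hf.dist_le_mul (A s) (A' s)
      rw [dist_eq_norm, dist_eq_norm] at h2
      exact (h1.trans h2).trans (by gcongr; exact hd s)
  have hC0 : 0 ≤ C := by positivity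
  have hτn : ‖τ t - τ' t‖ ≤ C * d :=
    (ContinuousMap.norm_le _ (by positivity)).2 fun x => hτsub x
  have hwn : ‖delayedState hA (τ t) t - delayedState hA' (τ' t) t‖ ≤ K * (C * d) + d := by
    refine (ContinuousMap.norm_le _ (by positivity)).2 fun p => ?_
    have h1 := hK _ _ (hwin p.1) (hwin' p.1)
    have h2 := hd (t - τ' t p.1)
    have h3 : |t - τ t p.1 - (t - τ' t p.1)| ≤ C * d := by
      rw [sub_sub_sub_cancel_left, abs_sub_comm]
      exact hτsub p.1
    have h4 : K * |t - τ t p.1 - (t - τ' t p.1)| ≤ K * (C * d) := by gcongr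
    have h5 := (A (t - τ t p.1) - A' (t - τ' t p.1)).norm_coe_le_norm p.2
    have h6 := norm_sub_le_norm_sub_add_norm_sub (A (t - τ t p.1)) (A (t - τ' t p.1))
      (A' (t - τ' t p.1))
    change ‖(A (t - τ t p.1) - A' (t - τ' t p.1)) p.2‖ ≤ _
    linarith
  have h := hL (A t) (τ t) (delayedState hA (τ t) t) (A' t) (τ' t) (delayedState hA' (τ' t) t)
    (hAQ t (by linarith)) (hτ.norm_le ht hτ₀ hQ hTQ)
    (norm_delayedState_le hA hQ fun x => hAQ _ (hwin x))
    (hAQ' t (by linarith)) (hτ'.norm_le ht hτ₀ hQ hTQ)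
    (norm_delayedState_le hA' hQ fun x => hAQ' _ (hwin' x))
  refine h.trans ?_
  rw [mul_assoc]
  gcongr
  linarith [hd t]

end Estimates

section Solutions

variable {F : C(X, ℝ) → C(X, ℝ) → C(X × X, ℝ) → C(X, ℝ)} {f : C(X, ℝ) → C(X, ℝ)}
  {φ : ℝ → C(X, ℝ)} {τ₀ : C(X, ℝ)} {r : ℝ} {hr : 0 ≤ r} {a : C(Icc (0 : ℝ) r, C(X, ℝ))}
  {τ : ℝ → C(X, ℝ)}

theorem isSolutionOn_prolong (hF : LipschitzOnBoundedSets F)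
    (hA : Continuous (prolong φ hr a)) (ha0 : a ⟨0, left_mem_Icc.2 hr⟩ = φ 0)
    (hτc : Continuous τ) (hτ₀ : ∀ x, 0 ≤ τ₀ x)
    (hτ : ∀ t, 0 ≤ t → IsThresholdDelay (fun s => f (prolong φ hr a s)) τ₀ t (τ t))
    (ha : ∀ t : Icc (0 : ℝ) r, a t = φ 0 + ∫ l in (0 : ℝ)..t, delayField F hA τ l) :
    IsSolutionOn F f φ τ₀ r (prolong φ hr a) τ := by
  refine ⟨hA.continuousOn, hτc.continuousOn, fun t ht x => (hτ t ht.1 x).1,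
    fun t ht => prolong_of_nonpos ha0 ht,
    ⟨fun l => delayedState hA (τ l) l, fun l _ x y => rfl, fun t ht x => ?_⟩, fun t ht x => ?_⟩
  · rw [prolong_of_mem ht, ha, ContinuousMap.add_apply,
      ContinuousMap.intervalIntegral_apply (continuous_delayField hF hA hτc)]
    rfl
  · rw [(hτ t ht.1 x).2.2]
    refine integral_congr fun s hs => ?_
    rw [uIcc_of_le (by linarith [hτ₀ x])] at hs
    simp only [prolong_of_nonpos ha0 hs.2]

theorem IsSolutionOn.eq_delay_and_eq_integral (hF : LipschitzOnBoundedSets F)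
    (hfc : Continuous f) (hf : ∀ ψ x, 0 < f ψ x) {A' τ' : ℝ → C(X, ℝ)}
    (hsol : IsSolutionOn F f φ τ₀ r A' τ') (hA : Continuous (prolong φ hr a))
    (haA : ∀ t : Icc (0 : ℝ) r, a t = A' t) (hτc : Continuous τ) (hτ₀ : ∀ x, 0 ≤ τ₀ x)
    (hτ : ∀ t, 0 ≤ t → IsThresholdDelay (fun s => f (prolong φ hr a s)) τ₀ t (τ t)) :
    (∀ t ∈ Icc 0 r, τ' t = τ t) ∧
      ∀ t : Icc (0 : ℝ) r, a t = φ 0 + ∫ l in (0 : ℝ)..t, delayField F hA τ l := by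
  obtain ⟨-, -, hτ'0, hhist, ⟨w, hw, hint⟩, hthr⟩ := hsol
  have ha0 : a ⟨0, left_mem_Icc.2 hr⟩ = φ 0 := by rw [haA, hhist _ le_rfl]
  have hprol : ∀ t ≤ r, A' t = prolong φ hr a t := fun t ht => by
    rcases le_total t 0 with h | h
    · rw [prolong_of_nonpos ha0 h, hhist t h]
    · rw [prolong_of_mem ⟨h, ht⟩, haA]
  have hττ : ∀ t ∈ Icc 0 r, τ' t = τ t := fun t ht => by
    ext x
    have h1 : ∫ s in (t - τ' t x)..t, f (A' s) x =
        ∫ s in (t - τ' t x)..t, f (prolong φ hr a s) x := by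
      refine integral_congr fun s hs => ?_
      rw [uIcc_of_le (by linarith [hτ'0 t ht x])] at hs
      simp only [hprol s (hs.2.trans ht.2)]
    have h2 : ∫ s in (-(τ₀ x))..0, f (φ s) x =
        ∫ s in (-(τ₀ x))..0, f (prolong φ hr a s) x := by
      refine integral_congr fun s hs => ?_
      rw [uIcc_of_le (by linarith [hτ₀ x])] at hs
      simp only [prolong_of_nonpos ha0 hs.2]
    have h3 := eq_of_integral_eq_of_pos (g := fun s => f (prolong φ hr a s) x) (by fun_prop)
      (fun s => hf _ x) (h1.symm.trans ((hthr t ht x).trans (h2.trans (hτ t ht.1 x).2.2.symm)))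
    linarith
  refine ⟨hττ, fun t => ?_⟩
  ext x
  rw [haA, hint t t.2 x, ContinuousMap.add_apply,
    ContinuousMap.intervalIntegral_apply (continuous_delayField hF hA hτc)]
  congr 1
  refine integral_congr fun l hl => ?_
  rw [uIcc_of_le t.2.1] at hl
  have hl' : l ∈ Icc 0 r := ⟨hl.1, hl.2.trans t.2.2⟩
  have hwl : w l = delayedState hA (τ l) l := by
    ext ⟨x, y⟩
    rw [hw l hl', hprol _ (by linarith [hτ'0 l hl' x, hl'.2]), hττ l hl']
    rfl
  simp only [hwl, hprol l hl'.2, hττ l hl', delayField]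

end Solutions

/-- A curve driven by a field that is bounded by `B` as long as the curve stays in the ball of
radius `M` does not leave that ball before time `(M - ‖c‖) / B`. -/
theorem norm_lt_of_eq_integral {E : Type*} [NormedAddCommGroup E] [NormedSpace ℝ E] {r M B : ℝ}
    {u V : ℝ → E} {c : E} (hu : ContinuousOn u (Icc 0 r)) (hB0 : 0 ≤ B) (hBr : ‖c‖ + B * r < M)
    (hint : ∀ t ∈ Icc 0 r, u t = c + ∫ l in (0 : ℝ)..t, V l)
    (hB : ∀ t ∈ Icc 0 r, (∀ s ∈ Icc 0 t, ‖u s‖ ≤ M) → ‖V t‖ ≤ B) :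
    ∀ t ∈ Icc 0 r, ‖u t‖ < M := by
  by_contra! hcon
  have hclosed : IsClosed (Icc 0 r ∩ (fun t => ‖u t‖) ⁻¹' Ici M) :=
    hu.norm.preimage_isClosed_of_isClosed isClosed_Icc isClosed_Ici
  obtain ⟨t, ⟨ht, htM⟩, hmin⟩ :=
    (isCompact_Icc.of_isClosed_subset hclosed inter_subset_left).exists_isLeast hcon
  have hbound : ‖∫ l in (0 : ℝ)..t, V l‖ ≤ B * |t - 0| := by
    refine norm_integral_le_of_norm_le_const_ae ?_
    filter_upwards [Measure.ae_ne volume t] with l hlt hl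
    rw [uIoc_of_le ht.1] at hl
    refine hB l ⟨hl.1.le, hl.2.trans ht.2⟩ fun s hs => ?_
    by_contra! hs'
    have := hmin ⟨⟨hs.1, hs.2.trans (hl.2.trans ht.2)⟩, hs'.le⟩
    exact hlt (le_antisymm hl.2 (this.trans hs.2))
  rw [sub_zero, abs_of_nonneg ht.1] at hbound
  have h1 : ‖u t‖ ≤ ‖c‖ + ‖∫ l in (0 : ℝ)..t, V l‖ := hint t ht ▸ norm_add_le _ _
  have h2 : B * t ≤ B * r := by gcongr; exact ht.2
  have h3 : M ≤ ‖u t‖ := htM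
  linarith

/-- Well-posedness of the delay system on `[0, r]`, for `r` small in terms of bounds on the data. -/
theorem exists_isSolutionOn_unique
    {F : C(X, ℝ) → C(X, ℝ) → C(X × X, ℝ) → C(X, ℝ)} (hF : LipschitzOnBoundedSets F)
    {f : C(X, ℝ) → C(X, ℝ)} {Kf : ℝ≥0} (hf : LipschitzWith Kf f) (hfpos : ∀ ψ x, 0 < f ψ x)
    {M₀ M P Kφ Q L B m r T : ℝ} (hM : M₀ < M) (hT : 0 ≤ T) (hTQ : T + 1 ≤ Q)
    (hPQ : P + M + M₀ ≤ Q) (hL0 : 0 ≤ L)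
    (hL : ∀ u v : C(X, ℝ), ∀ w : C(X × X, ℝ), ∀ u' v' : C(X, ℝ), ∀ w' : C(X × X, ℝ),
      ‖u‖ ≤ Q → ‖v‖ ≤ Q → ‖w‖ ≤ Q → ‖u'‖ ≤ Q → ‖v'‖ ≤ Q → ‖w'‖ ≤ Q →
      ‖F u v w - F u' v' w'‖ ≤ L * (‖u - u'‖ + ‖v - v'‖ + ‖w - w'‖))
    (hB : ‖F 0 0 0‖ + L * (3 * Q) ≤ B) (hm0 : 0 < m)
    (hm : ∀ ψ : C(X, ℝ), ‖ψ‖ ≤ Q → ∀ x, m ≤ f ψ x)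
    (hr : 0 < r) (hr1 : r ≤ 1) (hBr : M₀ + B * r < M)
    (hcontr : L * (2 + (1 + (Kφ + B)) * (Kf * (2 * T + 1) / m)) * r ≤ 1 / 2)
    {φ : ℝ → C(X, ℝ)} {τ₀ : C(X, ℝ)} (hφ : ContinuousOn φ (Iic 0)) (hφ0 : ‖φ 0‖ ≤ M₀)
    (hφP : ∀ t ∈ Icc (-T) 0, ‖φ t‖ ≤ P) (hKφ : 0 ≤ Kφ)
    (hφK : ∀ t ∈ Icc (-T) 0, ∀ s ∈ Icc (-T) 0, ‖φ t - φ s‖ ≤ Kφ * |t - s|)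
    (hτ₀0 : ∀ x, 0 ≤ τ₀ x) (hτ₀ : ∀ x, τ₀ x ≤ T) :
    ∃ A τ : ℝ → C(X, ℝ), IsSolutionOn F f φ τ₀ r A τ ∧ (∀ t ∈ Icc (0 : ℝ) r, ‖A t‖ ≤ M) ∧
      ∀ A' τ' : ℝ → C(X, ℝ), IsSolutionOn F f φ τ₀ r A' τ' →
        ∀ t ∈ Icc (0 : ℝ) r, A' t = A t ∧ τ' t = τ t := by
  have hfc := hf.continuous
  have hB0 : 0 ≤ B := by
    have : 0 ≤ Q := by linarith
    exact le_trans (by positivity) hB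
  have hAc : ∀ a, Continuous (prolong φ hr.le a) := fun a => continuous_prolong hφ
  choose τ hτc hτ using fun a => exists_continuous_delay (g := fun s => f (prolong φ hr.le a s))
    (hfc.comp (hAc a)) (fun s x => hfpos _ x) hτ₀0
  set V := fun a => delayField F (hAc a) (τ a) with hV
  have hVc : ∀ a, Continuous (V a) := fun a => continuous_delayField hF (hAc a) (hτc a)
  have hVi : ∀ a s t, IntervalIntegrable (V a) volume s t := fun a s t =>
    (hVc a).intervalIntegrable s t
  set Φ : C(Icc (0 : ℝ) r, C(X, ℝ)) → C(Icc (0 : ℝ) r, C(X, ℝ)) := fun a =>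
    ⟨fun t => φ 0 + ∫ l in (0 : ℝ)..t, V a l, continuous_const.add
      ((continuous_primitive (hVi a) 0).comp continuous_subtype_val)⟩ with hΦ
  set S : Set C(Icc (0 : ℝ) r, C(X, ℝ)) := {a | a ⟨0, left_mem_Icc.2 hr.le⟩ = φ 0 ∧
    (∀ t, ‖a t‖ ≤ M) ∧ ∀ t s, ‖a t - a s‖ ≤ B * |(t : ℝ) - s|} with hS
  have hVB : ∀ a, ∀ t ∈ Icc 0 r, (∀ s : Icc (0 : ℝ) r, (s : ℝ) ≤ t → ‖a s‖ ≤ M) → ‖V a t‖ ≤ B := by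
    intro a t ht hM
    refine (norm_delayField_le hL0 hL (hAc a) (hτ a t ht.1) ht.1 (ht.2.trans hr1) hτ₀ hT hTQ
      fun s hs => ?_).trans hB
    refine (norm_prolong_le hT hφP hφ0 hs.1 (hM _ ?_)).trans hPQ
    have := monotone_projIcc hr.le hs.2
    rw [projIcc_of_mem hr.le ht] at this
    exact this
  have hSQ : ∀ a ∈ S, ∀ s, -T ≤ s → ‖prolong φ hr.le a s‖ ≤ Q := fun a ha s hs =>
    (norm_prolong_le hT hφP hφ0 hs (ha.2.1 _)).trans hPQ
  have hmem : ∀ a, (∀ t ∈ Icc 0 r, ‖V a t‖ ≤ B) → Φ a ∈ S := by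
    intro a ha
    refine ⟨by simp [hΦ], fun t => ?_, fun t s => ?_⟩
    · have h1 : ‖∫ l in (0 : ℝ)..t, V a l‖ ≤ B * |(t : ℝ) - 0| :=
        norm_integral_le_of_norm_le_const fun l hl => by
          rw [uIoc_of_le t.2.1] at hl
          exact ha l ⟨hl.1.le, hl.2.trans t.2.2⟩
      rw [sub_zero, abs_of_nonneg t.2.1] at h1
      have h2 : B * t ≤ B * r := by gcongr; exact t.2.2
      have h3 : ‖Φ a t‖ ≤ _ := norm_add_le (φ 0) (∫ l in (0 : ℝ)..t, V a l)
      linarith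
    · have e : Φ a t - Φ a s = ∫ l in (s : ℝ)..t, V a l := by
        simp only [hΦ, ContinuousMap.coe_mk, add_sub_add_left_eq_sub]
        exact integral_interval_sub_left (hVi a _ _) (hVi a _ _)
      rw [e]
      refine norm_integral_le_of_norm_le_const fun l hl => ha l ?_
      exact ordConnected_Icc.uIcc_subset s.2 t.2 (uIoc_subset_uIcc hl)
  have hmaps : MapsTo Φ S S := fun a ha => hmem a fun t ht => hVB a t ht fun s _ => ha.2.1 s
  have hdist : ∀ a ∈ S, ∀ b ∈ S, dist (Φ a) (Φ b) ≤ 1 / 2 * dist a b := by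
    intro a ha b hb
    refine (ContinuousMap.dist_le (by positivity)).2 fun t => ?_
    set k := L * (2 + (1 + (Kφ + B)) * (Kf * (2 * T + 1) / m)) with hk
    have hk0 : 0 ≤ k := by positivity
    have e : Φ a t - Φ b t = ∫ l in (0 : ℝ)..t, (V a l - V b l) := by
      simp only [hΦ, ContinuousMap.coe_mk, add_sub_add_left_eq_sub]
      exact (integral_sub (hVi a _ _) (hVi b _ _)).symm
    have h1 : ‖∫ l in (0 : ℝ)..t, (V a l - V b l)‖ ≤ k * dist a b * |(t : ℝ) - 0| := by
      refine norm_integral_le_of_norm_le_const fun l hl => ?_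
      rw [uIoc_of_le t.2.1] at hl
      exact norm_delayField_sub_le hL0 hL hf (hAc a) (hAc b) (hτ a l hl.1.le) (hτ b l hl.1.le)
        hl.1.le (hl.2.trans (t.2.2.trans hr1)) hτ₀0 hτ₀ hT hTQ (hSQ a ha) (hSQ b hb) hm0
        (fun s hs => hm _ (hSQ a ha s hs)) dist_nonneg norm_prolong_sub_prolong_le (by positivity)
        fun s s' hs hs' => norm_prolong_sub_le hT hφK hKφ hB0 ha.2.2 hs hs'
    rw [dist_eq_norm, e]
    rw [sub_zero, abs_of_nonneg t.2.1] at h1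
    calc _ ≤ k * dist a b * t := h1
      _ ≤ k * dist a b * r := by gcongr; exact t.2.2
      _ = k * r * dist a b := by ring
      _ ≤ 1 / 2 * dist a b := by gcongr
  have hSclosed : IsClosed S := by
    simp only [hS, ofPred_and, ofPred_forall]
    refine (isClosed_eq (by fun_prop) continuous_const).inter (.inter ?_ ?_)
    · exact isClosed_iInter fun t => isClosed_le (by fun_prop) continuous_const
    · exact isClosed_iInter fun t => isClosed_iInter fun s =>
        isClosed_le (by fun_prop) continuous_const
  have hconst : ContinuousMap.const _ (φ 0) ∈ S :=
    ⟨rfl, fun t => hφ0.trans hM.le, fun t s => by simp; positivity⟩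
  have hcw : ContractingWith (1 / 2) (hmaps.restrict Φ S S) :=
    ⟨by norm_num, LipschitzWith.of_dist_le_mul fun a b => by
      simpa [Subtype.dist_eq] using hdist a a.2 b b.2⟩
  obtain ⟨a, haS, hafix, -⟩ :=
    hcw.exists_fixedPoint' hSclosed.isComplete hmaps hconst (edist_ne_top _ _)
  refine ⟨prolong φ hr.le a, τ a, isSolutionOn_prolong hF (hAc a) haS.1 (hτc a) hτ₀0 (hτ a)
    (fun t => (DFunLike.congr_fun hafix.eq t).symm), fun t ht => ?_, fun A' τ' hsol => ?_⟩
  · rw [prolong_of_mem ht]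
    exact haS.2.1 _
  set b : C(Icc (0 : ℝ) r, C(X, ℝ)) :=
    ⟨fun t => A' t, (hsol.1.mono Icc_subset_Iic_self).domRestrict⟩ with hb
  obtain ⟨hττ, hint⟩ := hsol.eq_delay_and_eq_integral hF hfc hfpos (hAc b) (fun t => rfl) (hτc b)
    hτ₀0 (hτ b)
  have hbfix : Φ b = b := ContinuousMap.ext fun t => (hint t).symm
  have hbM : ∀ t ∈ Icc 0 r, ‖A' t‖ < M :=
    norm_lt_of_eq_integral (hsol.1.mono Icc_subset_Iic_self) hB0 (by linarith)
      (fun t ht => hint ⟨t, ht⟩) fun t ht h => hVB b t ht fun s hs => h s ⟨s.2.1, hs⟩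
  have hbS : b ∈ S := hbfix ▸ hmem b fun t ht => hVB b t ht fun s _ => (hbM s s.2).le
  have hab : b = a := by
    have h := hdist b hbS a haS
    rw [hbfix, hafix.eq] at h
    exact dist_le_zero.1 (by linarith)
  intro t ht
  rw [prolong_of_mem ht, ← hab]
  exact ⟨rfl, hττ t ht⟩

theorem norm_weightedHist_le {α M₀ : ℝ} {φ : ℝ → C(X, ℝ)} (hφ : MemLipAlpha α φ)
    (h : lipAlphaNorm α φ ≤ M₀) {t : ℝ} (ht : t ≤ 0) : ‖weightedHist α φ t‖ ≤ M₀ := by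
  obtain ⟨-, ⟨C, hC⟩, -⟩ := hφ
  refine le_trans (le_csSup (s := {c | ∃ t ≤ (0 : ℝ), c = ‖weightedHist α φ t‖}) ⟨C, ?_⟩
    ⟨t, ht, rfl⟩) (le_trans (le_add_of_nonneg_right ?_) h)
  · rintro _ ⟨t, ht, rfl⟩
    exact hC t ht
  · refine Real.sSup_nonneg ?_
    rintro _ ⟨t, -, s, -, -, rfl⟩
    positivity

theorem norm_weightedHist_sub_le {α M₀ : ℝ} {φ : ℝ → C(X, ℝ)} (hφ : MemLipAlpha α φ)
    (h : lipAlphaNorm α φ ≤ M₀) {t s : ℝ} (ht : t ≤ 0) (hs : s ≤ 0) :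
    ‖weightedHist α φ t - weightedHist α φ s‖ ≤ M₀ * |t - s| := by
  obtain ⟨-, -, ⟨L, hL⟩⟩ := hφ
  rcases eq_or_ne t s with rfl | hts
  · simp
  have hpos : ∀ {t s : ℝ}, t ≠ s → 0 < |t - s| := fun h => abs_pos.2 (sub_ne_zero.2 h)
  rw [← div_le_iff₀ (hpos hts)]
  refine le_trans (le_csSup (s := {c | ∃ t ≤ (0 : ℝ), ∃ s ≤ (0 : ℝ), t ≠ s ∧
    c = ‖weightedHist α φ t - weightedHist α φ s‖ / |t - s|}) ⟨L, ?_⟩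
    ⟨t, ht, s, hs, hts, rfl⟩) (le_trans (le_add_of_nonneg_left ?_) h)
  · rintro _ ⟨t, ht, s, hs, hts, rfl⟩
    rw [div_le_iff₀ (hpos hts), ← dist_eq_norm, ← Real.dist_eq]
    exact hL.dist_le_mul t ht s hs
  · refine Real.sSup_nonneg ?_
    rintro _ ⟨t, -, rfl⟩
    positivity

theorem abs_exp_sub_exp_le {u v c : ℝ} (hu : u ≤ c) (hv : v ≤ c) :
    |Real.exp u - Real.exp v| ≤ Real.exp c * |u - v| := by
  wlog huv : v ≤ u generalizing u v
  · rw [abs_sub_comm, abs_sub_comm u]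
    exact this hv hu (le_of_not_ge huv)
  rw [abs_of_nonneg (sub_nonneg.2 (Real.exp_le_exp.2 huv)), abs_of_nonneg (sub_nonneg.2 huv)]
  have h1 : Real.exp v = Real.exp u * Real.exp (v - u) := by rw [← Real.exp_add]; ring_nf
  have h2 := Real.add_one_le_exp (v - u)
  calc Real.exp u - Real.exp v = Real.exp u * (1 - Real.exp (v - u)) := by rw [h1]; ring
    _ ≤ Real.exp u * (u - v) :=
      mul_le_mul_of_nonneg_left (by linarith) (Real.exp_pos u).le
    _ ≤ Real.exp c * (u - v) := by
      have := sub_nonneg.2 huv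
      gcongr

theorem norm_history_le {α M₀ T : ℝ} {φ : ℝ → C(X, ℝ)} (hα : 0 ≤ α) (hφ : MemLipAlpha α φ)
    (h : lipAlphaNorm α φ ≤ M₀) {t : ℝ} (ht : t ∈ Icc (-T) 0) :
    ‖φ t‖ ≤ Real.exp (α * T) * M₀ := by
  rw [eq_exp_smul_weightedHist α φ t, norm_smul, Real.norm_of_nonneg (Real.exp_pos _).le,
    abs_of_nonpos ht.2]
  have h1 := norm_weightedHist_le hφ h ht.2
  have h2 := ht.1
  gcongr
  linarith

theorem norm_history_sub_le {α M₀ T : ℝ} {φ : ℝ → C(X, ℝ)} (hα : 0 ≤ α)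
    (hφ : MemLipAlpha α φ) (h : lipAlphaNorm α φ ≤ M₀) {t s : ℝ} (ht : t ∈ Icc (-T) 0)
    (hs : s ∈ Icc (-T) 0) : ‖φ t - φ s‖ ≤ Real.exp (α * T) * M₀ * (1 + α) * |t - s| := by
  have hbd : ∀ {t}, t ∈ Icc (-T) 0 → |t| ≤ T := fun {t} ht => by
    rw [abs_of_nonpos ht.2]
    linarith [ht.1]
  have e : φ t - φ s = Real.exp (α * |t|) • (weightedHist α φ t - weightedHist α φ s) +
      (Real.exp (α * |t|) - Real.exp (α * |s|)) • weightedHist α φ s := by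
    nth_rw 1 [eq_exp_smul_weightedHist α φ t, eq_exp_smul_weightedHist α φ s]
    module
  have h1 := norm_weightedHist_sub_le hφ h ht.2 hs.2
  have h2 := norm_weightedHist_le hφ h hs.2
  have h3 := abs_exp_sub_exp_le (mul_le_mul_of_nonneg_left (hbd ht) hα)
    (mul_le_mul_of_nonneg_left (hbd hs) hα)
  have h4 : |(α * |t| - α * |s|)| ≤ α * |t - s| := by
    rw [← mul_sub, abs_mul, abs_of_nonneg hα]
    exact mul_le_mul_of_nonneg_left (abs_abs_sub_abs_le t s) hα
  rw [e]
  refine (norm_add_le _ _).trans ?_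
  rw [norm_smul, norm_smul, Real.norm_of_nonneg (Real.exp_pos _).le, Real.norm_eq_abs]
  calc _ ≤ Real.exp (α * T) * (M₀ * |t - s|) + Real.exp (α * T) * (α * |t - s|) * M₀ := by
        gcongr
        · exact hbd ht
        · exact h3.trans (by gcongr)
    _ = _ := by ring

end DelaySystem

/-- local existence and uniqueness of solutions of system (1.1), with
existence time r = r(M₀,M) uniform over initial distributions of Lip_α-norm at most M₀,
and the solution satisfies ‖A(t,·)‖_∞ ≤ M on [0,r]. -/
theorem stmt_13
    {n : ℕ} (hn : 1 ≤ n)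
    (Ω : Set (EuclideanSpace ℝ (Fin n))) (hΩ : IsCompact Ω) [CompactSpace Ω]
    (f : C(Ω, ℝ) → C(Ω, ℝ)) (Kf : ℝ≥0) (hf_lip : LipschitzWith Kf f)
    (hf_mono : ∀ u v : C(Ω, ℝ), u ≤ v → f v ≤ f u)
    (Mbar : ℝ) (hMbar : 0 < Mbar)
    (hf_bdd : ∀ (ψ : C(Ω, ℝ)) (x : Ω), 0 < f ψ x ∧ f ψ x ≤ Mbar)
    (F : C(Ω, ℝ) → C(Ω, ℝ) → C(Ω × Ω, ℝ) → C(Ω, ℝ))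
    (hF : LipschitzOnBoundedSets F)
    (α : ℝ) (hα : 0 ≤ α)
    (M₀ : ℝ) (hM₀ : 0 < M₀) :
    ∀ M : ℝ, M₀ < M → ∃ r : ℝ, 0 < r ∧
      ∀ φ : ℝ → C(Ω, ℝ), ∀ τ₀ : C(Ω, ℝ),
        MemLipAlpha α φ → (∀ x, 0 ≤ τ₀ x) →
        lipAlphaNorm α φ + ‖τ₀‖ ≤ M₀ →
        ∃ A τ : ℝ → C(Ω, ℝ),
          IsSolutionOn F f φ τ₀ r A τ ∧
          (∀ t ∈ Set.Icc (0 : ℝ) r, ‖A t‖ ≤ M) ∧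
          (∀ A' τ' : ℝ → C(Ω, ℝ), IsSolutionOn F f φ τ₀ r A' τ' →
            ∀ t ∈ Set.Icc (0 : ℝ) r, A' t = A t ∧ τ' t = τ t) := by
  intro M hM
  set P := Real.exp (α * M₀) * M₀ with hP
  have hP0 : 0 ≤ P := by positivity
  set Q := P + M + M₀ + 1 with hQ
  have hQ0 : 0 < Q := by linarith
  obtain ⟨L, hL0, hL⟩ := hF Q hQ0
  obtain ⟨m, hm0, hm⟩ := exists_pos_le_apply (f (.const _ Q)) fun x => (hf_bdd _ x).1
  set B := ‖F 0 0 0‖ + L * (3 * Q) with hB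
  set k := L * (2 + (1 + (P * (1 + α) + B)) * (Kf * (2 * M₀ + 1) / m)) with hk
  have hB0 : 0 < B := by positivity
  have hk0 : 0 < k := by positivity
  have hMM : 0 < M - M₀ := sub_pos.2 hM
  set r := min 1 (min ((M - M₀) / (2 * B)) (1 / (2 * k))) with hr
  have hrB : r ≤ (M - M₀) / (2 * B) := (min_le_right _ _).trans (min_le_left _ _)
  have hrk : r ≤ 1 / (2 * k) := (min_le_right _ _).trans (min_le_right _ _)
  rw [le_div_iff₀ (by positivity)] at hrB hrk
  refine ⟨r, by positivity, fun φ τ₀ hφ hτ₀ hnorm => ?_⟩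
  have hφn : lipAlphaNorm α φ ≤ M₀ := by linarith [norm_nonneg τ₀]
  have hlip0 : 0 ≤ lipAlphaNorm α φ :=
    (norm_nonneg _).trans (norm_weightedHist_le hφ le_rfl (le_refl 0))
  have hφ0 : ‖φ 0‖ ≤ M₀ := by
    simpa using norm_history_le (T := 0) hα hφ hφn (t := 0) (by simp)
  refine exists_isSolutionOn_unique hF hf_lip (fun ψ x => (hf_bdd ψ x).1) (Q := Q) (m := m)
    hM hM₀.le (by linarith) (by linarith) hL0.le hL hB.ge hm0 (fun ψ hψ x => ?_) (by positivity)
    (min_le_left _ _) (by linarith) (by linarith) hφ.1 hφ0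
    (fun t ht => norm_history_le hα hφ hφn ht) (by positivity)
    (fun t ht s hs => norm_history_sub_le hα hφ hφn ht hs) hτ₀ fun x => ?_
  · refine (hm x).trans (hf_mono ψ _ (fun y => ?_) x)
    exact (le_abs_self _).trans ((ψ.norm_coe_le_norm y).trans hψ)
  · exact (le_abs_self _).trans ((τ₀.norm_coe_le_norm x).trans (by linarith))
end

section
/- Let (A,τ) be a solution of system (1.1) on [0,T) with T < +∞ and initial distribution (φ,τ₀) ∈ Lip_α × C_+(Ω), and suppose sup_{t∈[0,T)} ‖A(t,·)‖_∞ < +∞. Then the solution is not maximal: there exist T′ > T and a solution (A′,τ′) of system (1.1) on [0,T′) with the same initial distribution (φ,τ₀) such that A′ coincides with A on (−∞,T) and τ′ coincides with τ on [0,T). Equivalently, if the maximal time of existence T_BU(φ,τ₀) := sup{t > 0 : system (1.1) has a solution on [0,t] with initial distribution (φ,τ₀)} is finite, then limsup_{t↗T_BU(φ,τ₀)} ‖A(t,·)‖_∞ = +∞. -/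
open scoped NNReal
open MeasureTheory intervalIntegral Set

/-- A solution of system (1.1) on the half-open interval [0,T) (T ∈ (0,+∞], encoded as
an extended real number) with initial distribution (φ,τ₀). -/
def IsSolutionUpTo {Ω : Type*} [TopologicalSpace Ω] [CompactSpace Ω]
    (F : C(Ω, ℝ) → C(Ω, ℝ) → C(Ω × Ω, ℝ) → C(Ω, ℝ))
    (f : C(Ω, ℝ) → C(Ω, ℝ))
    (φ : ℝ → C(Ω, ℝ)) (τ₀ : C(Ω, ℝ)) (T : EReal)
    (A : ℝ → C(Ω, ℝ)) (τ : ℝ → C(Ω, ℝ)) : Prop :=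
  ContinuousOn A {t : ℝ | (t : EReal) < T} ∧
  ContinuousOn τ {t : ℝ | 0 ≤ t ∧ (t : EReal) < T} ∧
  (∀ t : ℝ, 0 ≤ t → (t : EReal) < T → ∀ x : Ω, 0 ≤ τ t x) ∧
  (∀ t ≤ (0 : ℝ), A t = φ t) ∧
  (∃ w : ℝ → C(Ω × Ω, ℝ),
    (∀ l : ℝ, 0 ≤ l → (l : EReal) < T → ∀ x y : Ω, w l (x, y) = A (l - τ l x) y) ∧
    (∀ t : ℝ, 0 ≤ t → (t : EReal) < T → ∀ x : Ω,
      A t x = φ 0 x + ∫ l in (0 : ℝ)..t, F (A l) (τ l) (w l) x)) ∧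
  (∀ t : ℝ, 0 ≤ t → (t : EReal) < T → ∀ x : Ω,
    (∫ s in (t - τ t x)..t, f (A s) x) = ∫ s in (-(τ₀ x))..(0 : ℝ), f (φ s) x)

section Superposition

variable {X : Type*} [TopologicalSpace X] [CompactSpace X]
  {F : C(X, ℝ) → C(X, ℝ) → C(X × X, ℝ) → C(X, ℝ)}

theorem LipschitzOnBoundedSets.continuous (hF : LipschitzOnBoundedSets F) :
    Continuous fun p : C(X, ℝ) × C(X, ℝ) × C(X × X, ℝ) => F p.1 p.2.1 p.2.2 := by
  refine continuous_iff_continuousAt.2 fun p => ?_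
  obtain ⟨L, -, hL⟩ := hF (‖p‖ + 1) (by positivity)
  have bound : ∀ q : C(X, ℝ) × C(X, ℝ) × C(X × X, ℝ), ‖q‖ ≤ ‖p‖ + 1 →
      ‖q.1‖ ≤ ‖p‖ + 1 ∧ ‖q.2.1‖ ≤ ‖p‖ + 1 ∧ ‖q.2.2‖ ≤ ‖p‖ + 1 := fun q hq =>
    ⟨(norm_fst_le q).trans hq, (norm_fst_le q.2).trans ((norm_snd_le q).trans hq),
      (norm_snd_le q.2).trans ((norm_snd_le q).trans hq)⟩
  rw [ContinuousAt, tendsto_iff_norm_sub_tendsto_zero]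
  have hlim : Filter.Tendsto (fun q : C(X, ℝ) × C(X, ℝ) × C(X × X, ℝ) =>
      L * (‖q.1 - p.1‖ + ‖q.2.1 - p.2.1‖ + ‖q.2.2 - p.2.2‖)) (nhds p) (nhds 0) := by
    have : Continuous fun q : C(X, ℝ) × C(X, ℝ) × C(X × X, ℝ) =>
      L * (‖q.1 - p.1‖ + ‖q.2.1 - p.2.1‖ + ‖q.2.2 - p.2.2‖) := by fun_prop
    simpa using this.tendsto p
  refine squeeze_zero' (.of_forall fun _ => norm_nonneg _) ?_ hlim
  filter_upwards [Metric.ball_mem_nhds p one_pos] with q hq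
  have hq' : ‖q‖ ≤ ‖p‖ + 1 := by
    have := norm_sub_norm_le q p
    rw [Metric.mem_ball, dist_eq_norm] at hq
    linarith
  obtain ⟨h1, h2, h3⟩ := bound q hq'
  obtain ⟨h4, h5, h6⟩ := bound p (by linarith)
  exact hL _ _ _ _ _ _ h1 h2 h3 h4 h5 h6

theorem LipschitzOnBoundedSets.exists_norm_le (hF : LipschitzOnBoundedSets F) {M : ℝ}
    (hM : 0 < M) : ∃ C : ℝ≥0, ∀ u v w, ‖u‖ ≤ M → ‖v‖ ≤ M → ‖w‖ ≤ M → ‖F u v w‖ ≤ C := by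
  obtain ⟨L, hL0, hL⟩ := hF M hM
  refine ⟨⟨‖F 0 0 0‖ + L * (M + M + M), by positivity⟩, fun u v w hu hv hw => ?_⟩
  have h := hL u v w 0 0 0 hu hv hw (by simpa using hM.le) (by simpa using hM.le)
    (by simpa using hM.le)
  simp only [sub_zero] at h
  have h' : L * (‖u‖ + ‖v‖ + ‖w‖) ≤ L * (M + M + M) := by gcongr
  have := norm_sub_norm_le (F u v w) (F 0 0 0)
  change _ ≤ ‖F 0 0 0‖ + L * (M + M + M)
  linarith

end Superposition

section DelayedEvaluation

variable {X : Type*} [TopologicalSpace X] [CompactSpace X]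

/-- The function `(x, y) ↦ B (σ x) y`. -/
def delayedEval (B : C(ℝ, C(X, ℝ))) (σ : C(X, ℝ)) : C(X × X, ℝ) where
  toFun p := B (σ p.1) p.2
  continuous_toFun := by fun_prop

@[simp]
theorem delayedEval_apply (B : C(ℝ, C(X, ℝ))) (σ : C(X, ℝ)) (p : X × X) :
    delayedEval B σ p = B (σ p.1) p.2 := rfl

theorem continuous_delayedEval (B : C(ℝ, C(X, ℝ))) : Continuous (delayedEval B) := by
  apply ContinuousMap.continuous_of_continuous_uncurry
  simp only [delayedEval_apply, Function.uncurry_def]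
  fun_prop

theorem norm_delayedEval_le {B : C(ℝ, C(X, ℝ))} {σ : C(X, ℝ)} {M : ℝ} (hM : 0 ≤ M)
    (hB : ∀ x, ‖B (σ x)‖ ≤ M) : ‖delayedEval B σ‖ ≤ M :=
  (ContinuousMap.norm_le _ hM).2 fun p => ((B (σ p.1)).norm_coe_le_norm p.2).trans (hB p.1)

theorem norm_delayedEval_sub_le {B B' : C(ℝ, C(X, ℝ))} {σ σ' : C(X, ℝ)} {K : ℝ≥0} {d : ℝ}
    (hB : LipschitzWith K B) (hd : ∀ s, ‖B s - B' s‖ ≤ d) :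
    ‖delayedEval B σ - delayedEval B' σ'‖ ≤ K * ‖σ - σ'‖ + d := by
  have hd0 : 0 ≤ d := (norm_nonneg _).trans (hd 0)
  refine (ContinuousMap.norm_le _ (by positivity)).2 fun p => ?_
  have h1 : ‖(B (σ p.1) - B (σ' p.1)) p.2‖ ≤ K * ‖σ - σ'‖ :=
    (ContinuousMap.norm_coe_le_norm _ _).trans
      ((hB.norm_sub_le _ _).trans
        (mul_le_mul_of_nonneg_left ((σ - σ').norm_coe_le_norm p.1) K.coe_nonneg))
  have h2 : ‖(B (σ' p.1) - B' (σ' p.1)) p.2‖ ≤ d :=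
    (ContinuousMap.norm_coe_le_norm _ _).trans (hd _)
  calc ‖(delayedEval B σ - delayedEval B' σ') p‖
      = ‖(B (σ p.1) - B (σ' p.1)) p.2 + (B (σ' p.1) - B' (σ' p.1)) p.2‖ := by simp
    _ ≤ _ := (norm_add_le _ _).trans (add_le_add h1 h2)

end DelayedEvaluation

section ThresholdDelay

theorem mul_abs_sub_le_abs_integral_sub {g : ℝ → ℝ} (hg : Continuous g) {m : ℝ}
    (hm : ∀ s, m ≤ g s) (a b t : ℝ) :
    m * |a - b| ≤ |(∫ s in b..t, g s) - ∫ s in a..t, g s| := by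
  have key : ∀ a b : ℝ, a ≤ b → m * (b - a) ≤ ∫ s in a..b, g s := fun a b hab => by
    have := intervalIntegral.integral_mono_on hab (_root_.intervalIntegrable_const (μ := volume) (c := m))
      (hg.intervalIntegrable (μ := volume) a b) fun s _ => hm s
    simpa [mul_comm] using this
  have hsub : ∀ a b : ℝ, (∫ s in a..t, g s) - ∫ s in b..t, g s = ∫ s in a..b, g s := fun a b => by
    rw [← intervalIntegral.integral_add_adjacent_intervals (hg.intervalIntegrable a b)
      (hg.intervalIntegrable b t), add_sub_cancel_right]
  rw [hsub]
  rcases le_total a b with hab | hab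
  · rw [intervalIntegral.integral_symm, abs_neg, abs_sub_comm, abs_of_nonneg (sub_nonneg.2 hab)]
    exact (key a b hab).trans (le_abs_self _)
  · rw [abs_of_nonneg (sub_nonneg.2 hab)]
    exact (key b a hab).trans (le_abs_self _)

theorem le_of_integral_eq_of_pos {g : ℝ → ℝ} (hg : Continuous g) (hpos : ∀ s, 0 < g s)
    {a b c t : ℝ} (hct : c ≤ t) (h : ∫ s in a..t, g s = ∫ s in b..c, g s) : b ≤ a := by
  by_contra! hab
  have h1 : 0 < ∫ s in a..b, g s :=
    intervalIntegral.intervalIntegral_pos_of_pos (hg.intervalIntegrable _ _) hpos hab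
  have h2 : 0 ≤ ∫ s in c..t, g s :=
    intervalIntegral.integral_nonneg hct fun s _ => (hpos s).le
  have h3 := intervalIntegral.integral_add_adjacent_intervals
    (hg.intervalIntegrable (μ := volume) a b) (hg.intervalIntegrable b c)
  have h4 := intervalIntegral.integral_add_adjacent_intervals
    (hg.intervalIntegrable (μ := volume) a c) (hg.intervalIntegrable c t)
  linarith

theorem exists_le_integral_eq {g : ℝ → ℝ} (hg : Continuous g) {m : ℝ} (hm0 : 0 < m)
    (hm : ∀ s, m ≤ g s) (t : ℝ) {c : ℝ} (hc : 0 ≤ c) : ∃ σ ≤ t, ∫ s in σ..t, g s = c := by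
  have hle : t - c / m ≤ t := sub_le_self _ (by positivity)
  have hcont : Continuous fun σ => ∫ s in σ..t, g s := by
    simp_rw [intervalIntegral.integral_symm t]
    exact (intervalIntegral.continuous_primitive (fun _ _ => hg.intervalIntegrable _ _) t).neg
  have hlow : c ≤ ∫ s in (t - c / m)..t, g s := by
    have := intervalIntegral.integral_mono_on hle (_root_.intervalIntegrable_const (μ := volume) (c := m))
      (hg.intervalIntegrable (μ := volume) _ _) fun s _ => hm s
    have hcm : c / m * m = c := div_mul_cancel₀ _ hm0.ne'
    simpa [hcm] using this
  obtain ⟨σ, hσ, hσc⟩ := intermediate_value_Icc' hle hcont.continuousOn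
    (show c ∈ Icc _ _ from ⟨by simpa using hc, hlow⟩)
  exact ⟨σ, hσ.2, hσc⟩

variable {X : Type*} [TopologicalSpace X] [CompactSpace X]

theorem continuous_integral_apply {g : ℝ → C(X, ℝ)} (hg : Continuous g) :
    Continuous fun p : ℝ × ℝ × X => ∫ s in p.1..p.2.1, g s p.2.2 := by
  have h : ∀ e : ℝ × ℝ × X → ℝ, Continuous e →
      Continuous fun p : ℝ × ℝ × X => ∫ s in (0 : ℝ)..e p, g s p.2.2 := fun e he =>
    intervalIntegral.continuous_parametric_intervalIntegral_of_continuous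
      (f := fun (p : ℝ × ℝ × X) s => g s p.2.2) (by simp only [Function.uncurry_def]; fun_prop) he
  have heq : (fun p : ℝ × ℝ × X => ∫ s in p.1..p.2.1, g s p.2.2) =
      fun p => (∫ s in (0 : ℝ)..p.2.1, g s p.2.2) - ∫ s in (0 : ℝ)..p.1, g s p.2.2 := by
    funext p
    have hgi : Continuous fun s => g s p.2.2 := by fun_prop
    rw [intervalIntegral.integral_interval_sub_left (hgi.intervalIntegrable _ _)
      (hgi.intervalIntegrable _ _)]
  rw [heq]
  exact (h _ (by fun_prop)).sub (h _ (by fun_prop))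

/-- A threshold condition with a positive kernel has a continuous solution. -/
theorem exists_continuous_threshold {g : ℝ → C(X, ℝ)} (hg : Continuous g) {m : ℝ} (hm0 : 0 < m)
    (hm : ∀ s x, m ≤ g s x) (c : C(X, ℝ)) (hc : ∀ x, 0 ≤ c x) :
    ∃ σ : ℝ → C(X, ℝ), Continuous σ ∧
      ∀ t x, σ t x ≤ t ∧ ∫ s in (σ t x)..t, g s x = c x := by
  have hgx : ∀ x, Continuous fun s => g s x := fun x => by fun_prop
  choose σ hσt hσ using fun (t : ℝ) (x : X) =>
    exists_le_integral_eq (hgx x) hm0 (fun s => hm s x) t (hc x)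
  have hcont : Continuous (Function.uncurry σ) := by
    refine continuous_iff_continuousAt.2 fun q => ?_
    rw [ContinuousAt, tendsto_iff_norm_sub_tendsto_zero]
    have hlim : Filter.Tendsto (fun p : ℝ × X =>
        |(∫ s in (σ q.1 q.2)..p.1, g s p.2) - c p.2| / m) (nhds q) (nhds 0) := by
      have : Continuous fun p : ℝ × X =>
          |(∫ s in (σ q.1 q.2)..p.1, g s p.2) - c p.2| / m := by
        have h := (continuous_integral_apply hg).comp
          (show Continuous fun p : ℝ × X => (σ q.1 q.2, p.1, p.2) by fun_prop)
        have h' : Continuous fun p : ℝ × X => ∫ s in (σ q.1 q.2)..p.1, g s p.2 := h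
        fun_prop
      simpa [hσ] using this.tendsto q
    refine squeeze_zero (fun _ => norm_nonneg _) (fun p => ?_) hlim
    rw [le_div_iff₀ hm0, mul_comm, ← hσ p.1 p.2]
    exact mul_abs_sub_le_abs_integral_sub (hgx p.2) (fun s => hm s p.2) _ _ _
  refine ⟨fun t => ⟨σ t, by fun_prop⟩, ?_, fun t x => ⟨hσt t x, hσ t x⟩⟩
  exact ContinuousMap.continuous_of_continuous_uncurry _ hcont

end ThresholdDelay

section LipschitzCurves

variable {E : Type*} [NormedAddCommGroup E]

/-- A Lipschitz curve on `[a, T)` with values in a complete space is the restriction of a globally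
Lipschitz curve that is constant beyond `T`. -/
theorem LipschitzOnWith.exists_lipschitzWith_of_Ico [CompleteSpace E] {A : ℝ → E} {a T M : ℝ}
    {K : ℝ≥0} (haT : a < T) (hA : LipschitzOnWith K A (Ico a T))
    (hM : ∀ t ∈ Ico a T, ‖A t‖ ≤ M) :
    ∃ A₀ : ℝ → E, LipschitzWith K A₀ ∧ (∀ t ∈ Ico a T, A₀ t = A t) ∧
      (∀ t, T ≤ t → A₀ t = A₀ T) ∧ ∀ t, ‖A₀ t‖ ≤ M := by
  have hev : ∀ᶠ b in nhdsWithin T (Iio T), b ∈ Ico a T := Ico_mem_nhdsLT haT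
  have hclamp : ∀ t, ∀ b ∈ Ico a T, max a (min t b) ∈ Ico a T := fun t b hb =>
    ⟨le_max_left _ _, max_lt haT ((min_le_right _ _).trans_lt hb.2)⟩
  have hex : ∀ t, ∃ y, Filter.Tendsto (fun b => A (max a (min t b)))
      (nhdsWithin T (Iio T)) (nhds y) := fun t => by
    refine cauchy_map_iff_exists_tendsto.1 ?_
    have hL : LipschitzOnWith K (fun b => A (max a (min t b))) (Ico a T) := by
      refine LipschitzOnWith.of_dist_le_mul fun b hb b' hb' => ?_
      refine (hA.dist_le_mul _ (hclamp t b hb) _ (hclamp t b' hb')).trans ?_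
      gcongr
      rw [Real.dist_eq, Real.dist_eq]
      exact (abs_max_sub_max_le_max _ _ _ _).trans (by
        simpa using abs_min_sub_min_le_max t b t b')
    have hC : Cauchy (nhdsWithin T (Iio T)) := (cauchy_nhds (a := T)).mono nhdsWithin_le_nhds
    exact hC.map_of_le hL.uniformContinuousOn (Filter.le_principal_iff.2 hev)
  choose A₀ hA₀ using hex
  refine ⟨A₀, ?_, fun t ht => ?_, fun t ht => ?_, fun t => ?_⟩
  · refine LipschitzWith.of_dist_le_mul fun t s => ?_
    refine le_of_tendsto ((hA₀ t).dist (hA₀ s)) (hev.mono fun b hb => ?_)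
    refine (hA.dist_le_mul _ (hclamp t b hb) _ (hclamp s b hb)).trans ?_
    gcongr
    rw [Real.dist_eq, Real.dist_eq]
    exact (abs_max_sub_max_le_max _ _ _ _).trans (by
      simpa using abs_min_sub_min_le_max t b s b)
  · refine tendsto_nhds_unique (hA₀ t) (tendsto_const_nhds.congr' ?_)
    filter_upwards [Ico_mem_nhdsLT ht.2] with b hb
    rw [min_eq_left hb.1, max_eq_right ht.1]
  · refine tendsto_nhds_unique (hA₀ t) ((hA₀ T).congr' (hev.mono fun b hb => ?_))
    simp only [min_eq_right hb.2.le, min_eq_right (hb.2.le.trans ht)]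
  · exact le_of_tendsto (hA₀ t).norm (hev.mono fun b hb => hM _ (hclamp t b hb))

theorem LipschitzOnWith.Icc_union_Ico {A : ℝ → E} {a b c : ℝ} {K K' : ℝ≥0}
    (h : LipschitzOnWith K A (Icc a b)) (h' : LipschitzOnWith K' A (Ico b c)) :
    LipschitzOnWith (K + K') A (Ico a c) := by
  have key : ∀ s ∈ Ico a c, ∀ t ∈ Ico a c, s ≤ t →
      dist (A s) (A t) ≤ (K + K' : ℝ≥0) * dist s t := by
    intro s hs t ht hst
    have e : ∀ u v : ℝ, u ≤ v → dist u v = v - u := fun u v huv => by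
      rw [dist_comm, Real.dist_eq, abs_of_nonneg (sub_nonneg.2 huv)]
    have hK := K.coe_nonneg
    have hK' := K'.coe_nonneg
    rw [e s t hst, NNReal.coe_add]
    rcases le_total t b with htb | hbt
    · have := h.dist_le_mul s ⟨hs.1, hst.trans htb⟩ t ⟨ht.1, htb⟩
      rw [e s t hst] at this
      nlinarith
    rcases le_total b s with hbs | hsb
    · have := h'.dist_le_mul s ⟨hbs, hs.2⟩ t ⟨hbt, ht.2⟩
      rw [e s t hst] at this
      nlinarith
    · have h1 := h.dist_le_mul s ⟨hs.1, hsb⟩ b ⟨hs.1.trans hsb, le_rfl⟩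
      have h2 := h'.dist_le_mul b ⟨le_rfl, hbt.trans_lt ht.2⟩ t ⟨hbt, ht.2⟩
      rw [e _ _ hsb] at h1
      rw [e _ _ hbt] at h2
      have := dist_triangle (A s) (A b) (A t)
      nlinarith
  refine LipschitzOnWith.of_dist_le_mul fun s hs t ht => ?_
  rcases le_total s t with hst | hst
  · exact key s hs t ht hst
  · rw [dist_comm, dist_comm s]
    exact key t ht s hs hst

theorem MemLipAlpha.exists_lipschitzOnWith_Icc {X : Type*} [TopologicalSpace X] [CompactSpace X]
    {α : ℝ} {φ : ℝ → C(X, ℝ)} (hα : 0 ≤ α) (hφ : MemLipAlpha α φ) (R : ℝ) :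
    ∃ K : ℝ≥0, LipschitzOnWith K φ (Icc (-R) 0) := by
  obtain ⟨-, ⟨C, hC⟩, L, hL⟩ := hφ
  have hC0 : 0 ≤ C := (norm_nonneg _).trans (hC 0 le_rfl)
  set e : ℝ → ℝ := fun t => Real.exp (-(α * t)) with he
  have hφe : ∀ t ≤ 0, φ t = e t • weightedHist α φ t := fun t ht => by
    simp only [he, weightedHist, smul_smul, abs_of_nonpos ht, ← Real.exp_add]
    simp
  have he_le : ∀ t ∈ Icc (-R) 0, e t ≤ Real.exp (α * R) := fun t ht =>
    Real.exp_le_exp.2 (by nlinarith [ht.1])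
  have hderiv : ∀ t, HasDerivAt e (e t * -α) t := fun t => by
    simpa [he] using (((hasDerivAt_id t).const_mul α).neg).exp
  have he_sub : ∀ s ∈ Icc (-R) 0, ∀ t ∈ Icc (-R) 0, ‖e t - e s‖ ≤ Real.exp (α * R) * α * ‖t - s‖ :=
    fun s hs t ht =>
      Convex.norm_image_sub_le_of_norm_deriv_le (fun u _ => (hderiv u).differentiableAt)
        (fun u hu => by
          rw [(hderiv u).deriv, norm_mul, norm_neg, Real.norm_of_nonneg (Real.exp_pos _).le,
            Real.norm_of_nonneg hα]
          exact mul_le_mul_of_nonneg_right (he_le u hu) hα) (convex_Icc _ _) hs ht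
  refine ⟨⟨Real.exp (α * R) * L + Real.exp (α * R) * α * C, by positivity⟩,
    LipschitzOnWith.of_dist_le_mul fun t ht s hs => ?_⟩
  change _ ≤ (Real.exp (α * R) * L + Real.exp (α * R) * α * C) * _
  rw [dist_eq_norm, dist_eq_norm, hφe t ht.2, hφe s hs.2]
  have hsplit : e t • weightedHist α φ t - e s • weightedHist α φ s =
      e t • (weightedHist α φ t - weightedHist α φ s) + (e t - e s) • weightedHist α φ s := by
    module
  have h1 : ‖e t • (weightedHist α φ t - weightedHist α φ s)‖ ≤
      Real.exp (α * R) * (L * ‖t - s‖) := by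
    rw [norm_smul, Real.norm_of_nonneg (Real.exp_pos _).le]
    exact mul_le_mul (he_le t ht) (hL.norm_sub_le ht.2 hs.2) (norm_nonneg _) (Real.exp_pos _).le
  have h2 : ‖(e t - e s) • weightedHist α φ s‖ ≤ Real.exp (α * R) * α * ‖t - s‖ * C := by
    rw [norm_smul]
    exact mul_le_mul (he_sub s hs t ht) (hC s hs.2) (norm_nonneg _) (by positivity)
  rw [hsplit]
  refine (norm_add_le _ _).trans ((add_le_add h1 h2).trans_eq (by ring))

end LipschitzCurves

section FixedPoint

variable {E : Type*} [NormedAddCommGroup E]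

open scoped BoundedContinuousFunction

/-- The bounded `K`-Lipschitz curves that agree with `A₀` up to time `T` and are bounded
by `M`. -/
def extensionClass (A₀ : ℝ → E) (T M : ℝ) (K : ℝ≥0) : Set (ℝ →ᵇ E) :=
  {B | LipschitzWith K B ∧ (∀ t, ‖B t‖ ≤ M) ∧ ∀ t ≤ T, B t = A₀ t}

theorem isClosed_extensionClass (A₀ : ℝ → E) (T M : ℝ) (K : ℝ≥0) :
    IsClosed (extensionClass A₀ T M K) := by
  have hev : ∀ t : ℝ, Continuous fun B : ℝ →ᵇ E => B t := fun t =>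
    continuous_eval_const t
  simp only [extensionClass, lipschitzWith_iff_dist_le_mul, Set.ofPred_and, Set.ofPred_forall]
  refine .inter ?_ (.inter ?_ ?_)
  · exact isClosed_iInter fun s => isClosed_iInter fun t =>
      isClosed_le ((hev s).dist (hev t)) continuous_const
  · exact isClosed_iInter fun s => isClosed_le (hev s).norm continuous_const
  · exact isClosed_iInter fun s => isClosed_iInter fun _ => isClosed_eq (hev s) continuous_const

/-- Local solvability of `B(t) = A₀(T) + ∫_T^t N(B)(l) dl` for a functional right-hand side that is
bounded and Lipschitz on a class of extensions of `A₀`. -/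
theorem exists_local_extension [NormedSpace ℝ E] [CompleteSpace E] {A₀ : ℝ → E} {T M : ℝ}
    {K C L : ℝ≥0} (hA₀ : LipschitzWith K A₀) (hconst : ∀ t, T ≤ t → A₀ t = A₀ T)
    (hM : ∀ t, ‖A₀ t‖ ≤ M) (N : (ℝ →ᵇ E) → ℝ → E)
    (hNc : ∀ B ∈ extensionClass A₀ T (M + 1) (K + C), Continuous (N B))
    (hNb : ∀ B ∈ extensionClass A₀ T (M + 1) (K + C), ∀ l ∈ Icc T (T + 1), ‖N B l‖ ≤ C)
    (hNL : ∀ B ∈ extensionClass A₀ T (M + 1) (K + C), ∀ B' ∈ extensionClass A₀ T (M + 1) (K + C),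
      ∀ l ∈ Icc T (T + 1), ‖N B l - N B' l‖ ≤ L * ‖B - B'‖) :
    ∃ h > 0, ∃ B ∈ extensionClass A₀ T (M + 1) (K + C),
      ∀ t ∈ Icc T (T + h), B t = A₀ T + ∫ l in T..t, N B l := by
  set S := extensionClass A₀ T (M + 1) (K + C)
  have hD : (0 : ℝ) < C + 2 * L + 1 := by positivity
  set h : ℝ := 1 / (C + 2 * L + 1) with hh
  have hh0 : 0 < h := by positivity
  have hhD : h * (C + 2 * L + 1) = 1 := by rw [hh]; field_simp
  have hhC : 0 ≤ h * C := by positivity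
  have hhL : 0 ≤ h * L := by positivity
  have hTh : T ≤ T + h := by linarith
  set p : ℝ → ℝ := fun t => projIcc T (T + h) hTh t with hp
  have hpmem : ∀ t, p t ∈ Icc T (T + h) := fun t => (projIcc T (T + h) hTh t).2
  have hpsub : ∀ t s, |p t - p s| ≤ |t - s| := fun t s => abs_projIcc_sub_projIcc hTh
  have hmem : ∀ a b l, l ∈ uIoc (p a) (p b) → l ∈ Icc T (T + 1) := fun a b l hl => by
    have := (uIcc_subset_Icc (hpmem a) (hpmem b)) (uIoc_subset_uIcc hl)
    exact ⟨this.1, this.2.trans (by nlinarith)⟩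
  have hpT : p T = T := by simp [hp, projIcc_left]
  have hplen : ∀ t, |p t - T| ≤ h := fun t => by
    rw [abs_of_nonneg (sub_nonneg.2 (hpmem t).1)]
    linarith [(hpmem t).2]
  have hmemT : ∀ b l, l ∈ uIoc T (p b) → l ∈ Icc T (T + 1) := fun b l hl =>
    hmem T b l (by rwa [hpT])
  set Φ : (ℝ →ᵇ E) → ℝ → E := fun B t => A₀ t + ∫ l in T..p t, N B l with hΦ
  have hΦlip : ∀ B ∈ S, LipschitzWith (K + C) (Φ B) := fun B hB => by
    refine hA₀.add (LipschitzWith.of_dist_le_mul fun t s => ?_)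
    rw [dist_eq_norm, intervalIntegral.integral_interval_sub_left
      ((hNc B hB).intervalIntegrable _ _) ((hNc B hB).intervalIntegrable _ _)]
    refine (intervalIntegral.norm_integral_le_of_norm_le_const fun l hl =>
      hNb B hB l (hmem _ _ l hl)).trans ?_
    exact mul_le_mul_of_nonneg_left (hpsub t s) C.coe_nonneg
  have hΦbd : ∀ B ∈ S, ∀ t, ‖Φ B t‖ ≤ M + 1 := fun B hB t => by
    refine (norm_add_le _ _).trans (add_le_add (hM t) ?_)
    refine (intervalIntegral.norm_integral_le_of_norm_le_const fun l hl =>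
      hNb B hB l (hmemT _ l hl)).trans ?_
    have := mul_le_mul_of_nonneg_left (hplen t) C.coe_nonneg
    nlinarith
  have hΦT : ∀ B, ∀ t ≤ T, Φ B t = A₀ t := fun B t ht => by
    simp [hΦ, hp, projIcc_of_le_left hTh ht]
  let Ψ : S → S := fun B =>
    ⟨BoundedContinuousFunction.ofNormedAddCommGroup (Φ B) (hΦlip B B.2).continuous (M + 1)
      (hΦbd B B.2), hΦlip B B.2, hΦbd B B.2, hΦT B⟩
  have hΨ : ContractingWith (1 / 2) Ψ := by
    refine ⟨by norm_num, LipschitzWith.of_dist_le_mul fun B B' => ?_⟩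
    rw [Subtype.dist_eq, Subtype.dist_eq, BoundedContinuousFunction.dist_le (by positivity)]
    intro t
    change dist (Φ B t) (Φ B' t) ≤ _
    simp only [hΦ, dist_add_left]
    rw [dist_eq_norm, ← intervalIntegral.integral_sub ((hNc B B.2).intervalIntegrable _ _)
      ((hNc B' B'.2).intervalIntegrable _ _)]
    refine (intervalIntegral.norm_integral_le_of_norm_le_const fun l hl =>
      hNL B B.2 B' B'.2 l (hmemT _ l hl)).trans ?_
    rw [← dist_eq_norm]
    have h1 := mul_le_mul_of_nonneg_left (hplen t)
      (mul_nonneg L.coe_nonneg (dist_nonneg (x := (B : ℝ →ᵇ E)) (y := B')))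
    have h2 : L * h ≤ 1 / 2 := by nlinarith
    have h3 := mul_le_mul_of_nonneg_right h2 (dist_nonneg (x := (B : ℝ →ᵇ E)) (y := B'))
    push_cast
    nlinarith
  have : CompleteSpace S := (isClosed_extensionClass _ _ _ _).completeSpace_coe
  have : Nonempty S := ⟨BoundedContinuousFunction.ofNormedAddCommGroup A₀ hA₀.continuous M hM,
    hA₀.weaken le_self_add, fun t => (hM t).trans (by linarith), fun _ _ => rfl⟩
  set B := ContractingWith.fixedPoint Ψ hΨ
  have hB : Ψ B = B := hΨ.fixedPoint_isFixedPt
  refine ⟨h, hh0, B, B.2, fun t ht => ?_⟩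
  have hBt : Φ B t = (B : ℝ →ᵇ E) t := congrArg (fun b : S => (b : ℝ →ᵇ E) t) hB
  rw [← hBt]
  simp only [hΦ, hp, projIcc_of_mem hTh ht, hconst t ht.1]

end FixedPoint

section Continuation

variable {X : Type*} [TopologicalSpace X] [CompactSpace X]
  {F : C(X, ℝ) → C(X, ℝ) → C(X × X, ℝ) → C(X, ℝ)} {f : C(X, ℝ) → C(X, ℝ)}
  {φ A τ : ℝ → C(X, ℝ)} {τ₀ : C(X, ℝ)} {T : ℝ}

theorem IsSolutionUpTo.neg_le_sub_delay (hf : Continuous f) (hpos : ∀ ψ x, 0 < f ψ x)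
    (hτ₀ : ∀ x, 0 ≤ τ₀ x) (hsol : IsSolutionUpTo F f φ τ₀ T A τ) {t : ℝ} (ht0 : 0 ≤ t)
    (htT : t < T) (x : X) : -τ₀ x ≤ t - τ t x := by
  obtain ⟨hA, -, hτ, hAφ, -, hthr⟩ := hsol
  have hcont : Continuous fun s => A (min s t) :=
    hA.comp_continuous (by fun_prop) fun s =>
      EReal.coe_lt_coe_iff.2 ((min_le_right s t).trans_lt htT)
  have hτt := hτ t ht0 (EReal.coe_lt_coe_iff.2 htT) x
  refine le_of_integral_eq_of_pos (g := fun s => f (A (min s t)) x)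
    ((continuous_eval_const x).comp (hf.comp hcont)) (fun s => hpos _ x) ht0 ?_
  have h := hthr t ht0 (EReal.coe_lt_coe_iff.2 htT) x
  have e1 : (∫ s in (t - τ t x)..t, f (A s) x) =
      ∫ s in (t - τ t x)..t, f (A (min s t)) x :=
    intervalIntegral.integral_congr fun s hs => by
      rw [uIcc_of_le (by linarith)] at hs
      simp only [min_eq_left hs.2]
  have e2 : (∫ s in (-(τ₀ x))..(0 : ℝ), f (φ s) x) =
      ∫ s in (-(τ₀ x))..(0 : ℝ), f (A (min s t)) x :=
    intervalIntegral.integral_congr fun s hs => by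
      rw [uIcc_of_le (by linarith [hτ₀ x])] at hs
      simp only [min_eq_left (hs.2.trans ht0), hAφ s hs.2]
  rw [← e1, ← e2, h]

/-- A solution that is bounded on its interval of existence is Lipschitz there. -/
theorem IsSolutionUpTo.exists_lipschitzOnWith (hF : LipschitzOnBoundedSets F) (hf : Continuous f)
    (hpos : ∀ ψ x, 0 < f ψ x) (hτ₀ : ∀ x, 0 ≤ τ₀ x) (hT : 0 < T)
    (hsol : IsSolutionUpTo F f φ τ₀ T A τ) {M : ℝ} (hM : ∀ t ∈ Ico (-‖τ₀‖) T, ‖A t‖ ≤ M) :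
    ∃ C : ℝ≥0, LipschitzOnWith C A (Ico 0 T) := by
  have hlow := fun {t : ℝ} => hsol.neg_le_sub_delay hf hpos hτ₀ (t := t)
  obtain ⟨hA, hτc, hτ, hAφ, ⟨w, hw, hAw⟩, -⟩ := hsol
  have hM0 : 0 ≤ M := (norm_nonneg _).trans (hM 0 ⟨by simp, hT⟩)
  have hτ₀n : ∀ x, τ₀ x ≤ ‖τ₀‖ := fun x => (le_abs_self _).trans (τ₀.norm_coe_le_norm x)
  obtain ⟨C, hC⟩ := hF.exists_norm_le (M := M + (T + ‖τ₀‖)) (by positivity)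
  refine ⟨C, LipschitzOnWith.of_dist_le_mul fun t ht s hs => ?_⟩
  set b := max s t with hb
  have hbT : b < T := max_lt hs.2 ht.2
  have hb0 : 0 ≤ b := hs.1.trans (le_max_left _ _)
  let Ab : C(ℝ, C(X, ℝ)) := ⟨fun l => A (min l b), hA.comp_continuous (by fun_prop) fun l =>
    EReal.coe_lt_coe_iff.2 ((min_le_right l b).trans_lt hbT)⟩
  have hAb : ∀ l ≤ b, Ab l = A l := fun l hl => by
    change A (min l b) = A l
    rw [min_eq_left hl]
  let τb : ℝ → C(X, ℝ) := fun l => τ (projIcc 0 b hb0 l)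
  have hτb : ∀ l ∈ Icc 0 b, τb l = τ l := fun l hl => by
    simp only [τb, projIcc_of_mem hb0 hl]
  have hτbc : Continuous τb := hτc.comp_continuous
    (continuous_subtype_val.comp continuous_projIcc) fun l =>
      ⟨(projIcc 0 b hb0 l).2.1, EReal.coe_lt_coe_iff.2 ((projIcc 0 b hb0 l).2.2.trans_lt hbT)⟩
  let N : ℝ → C(X, ℝ) := fun l =>
    F (Ab l) (τb l) (delayedEval Ab (ContinuousMap.const X l - τb l))
  have hNc : Continuous N := by
    have h1 : Continuous fun l => ContinuousMap.const X l - τb l :=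
      (ContinuousMap.continuous_const').sub hτbc
    exact hF.continuous.comp (Ab.continuous.prodMk
      (hτbc.prodMk ((continuous_delayedEval Ab).comp h1)))
  have hNeq : ∀ l ∈ Icc 0 b, F (A l) (τ l) (w l) = N l := fun l hl => by
    have hwl : w l = delayedEval Ab (ContinuousMap.const X l - τb l) := by
      ext ⟨x, y⟩
      have hlT := EReal.coe_lt_coe_iff.2 (hl.2.trans_lt hbT)
      rw [hw l hl.1 hlT, delayedEval_apply, hτb l hl]
      simp only [ContinuousMap.sub_apply, ContinuousMap.const_apply]
      rw [hAb _ (by linarith [hτ l hl.1 hlT x, hl.2])]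
    simp only [N, hwl, hAb l hl.2, hτb l hl]
  have hNb : ∀ l ∈ Icc 0 b, ‖N l‖ ≤ C := fun l hl => by
    have hlT : l < T := hl.2.trans_lt hbT
    have hMT : M ≤ M + (T + ‖τ₀‖) := le_add_of_nonneg_right (by positivity)
    refine hC _ _ _ ?_ ?_ ?_
    · rw [hAb l hl.2]
      exact (hM l ⟨by linarith [norm_nonneg τ₀, hl.1], hlT⟩).trans hMT
    · rw [hτb l hl]
      refine (ContinuousMap.norm_le _ (by positivity)).2 fun x => ?_
      rw [Real.norm_of_nonneg (hτ l hl.1 (EReal.coe_lt_coe_iff.2 hlT) x)]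
      linarith [hlow hl.1 hlT x, hτ₀n x]
    · refine (norm_delayedEval_le hM0 fun x => ?_).trans hMT
      simp only [ContinuousMap.sub_apply, ContinuousMap.const_apply, hτb l hl]
      have h1 := hτ l hl.1 (EReal.coe_lt_coe_iff.2 hlT) x
      rw [hAb _ (by linarith [hl.2])]
      exact hM _ ⟨by linarith [hlow hl.1 hlT x, hτ₀n x], by linarith⟩
  have hAN : ∀ u ∈ Icc 0 b, ∀ x, A u x = φ 0 x + ∫ l in (0 : ℝ)..u, N l x := fun u hu x => by
    rw [hAw u hu.1 (EReal.coe_lt_coe_iff.2 (hu.2.trans_lt hbT)) x]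
    congr 1
    refine intervalIntegral.integral_congr fun l hl => ?_
    rw [uIcc_of_le hu.1] at hl
    simp only [hNeq l ⟨hl.1, hl.2.trans hu.2⟩]
  have htb : t ∈ Icc 0 b := ⟨ht.1, le_max_right _ _⟩
  have hsb : s ∈ Icc 0 b := ⟨hs.1, le_max_left _ _⟩
  rw [dist_eq_norm, Real.dist_eq]
  refine (ContinuousMap.norm_le _ (by positivity)).2 fun x => ?_
  have hNx : Continuous fun l => N l x := by fun_prop
  rw [ContinuousMap.sub_apply, hAN t htb, hAN s hsb, add_sub_add_left_eq_sub,
    intervalIntegral.integral_interval_sub_left (hNx.intervalIntegrable _ _)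
      (hNx.intervalIntegrable _ _)]
  exact intervalIntegral.norm_integral_le_of_norm_le_const fun l hl =>
    ((N l).norm_coe_le_norm x).trans
      (hNb l (uIcc_subset_Icc hsb htb (uIoc_subset_uIcc hl)))

theorem exists_pos_le_of_antitone (hf_mono : ∀ u v : C(X, ℝ), u ≤ v → f v ≤ f u)
    (hpos : ∀ ψ x, 0 < f ψ x) (M : ℝ) : ∃ m > 0, ∀ ψ, ‖ψ‖ ≤ M → ∀ x, m ≤ f ψ x := by
  have hle : ∀ ψ : C(X, ℝ), ‖ψ‖ ≤ M → ∀ x, f (ContinuousMap.const X M) x ≤ f ψ x :=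
    fun ψ hψ => hf_mono ψ (ContinuousMap.const X M) fun x =>
      (le_abs_self _).trans ((ψ.norm_coe_le_norm x).trans hψ)
  rcases isEmpty_or_nonempty X with hX | hX
  · exact ⟨1, one_pos, fun _ _ x => hX.elim x⟩
  · obtain ⟨x₀, -, hx₀⟩ := isCompact_univ.exists_isMinOn univ_nonempty
      (f (ContinuousMap.const X M)).continuous.continuousOn
    exact ⟨_, hpos (ContinuousMap.const X M) x₀, fun ψ hψ x =>
      (hx₀ (mem_univ x)).trans (hle ψ hψ x)⟩

open scoped BoundedContinuousFunction in
/-- A solution that is Lipschitz and bounded up to its final time can be continued. -/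
theorem IsSolutionUpTo.exists_continuation {Kf : ℝ≥0} (hf_lip : LipschitzWith Kf f)
    (hf_mono : ∀ u v : C(X, ℝ), u ≤ v → f v ≤ f u) (hpos : ∀ ψ x, 0 < f ψ x)
    (hF : LipschitzOnBoundedSets F) (hτ₀ : ∀ x, 0 ≤ τ₀ x) (hT : 0 < T)
    (hsol : IsSolutionUpTo F f φ τ₀ T A τ) {R M : ℝ} (hR : ‖τ₀‖ < R) {K : ℝ≥0}
    (hA : LipschitzOnWith K A (Ico (-R) T)) (hM : ∀ t ∈ Ico (-R) T, ‖A t‖ ≤ M) :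
    ∃ T' : ℝ, T < T' ∧ ∃ A' τ' : ℝ → C(X, ℝ), IsSolutionUpTo F f φ τ₀ T' A' τ' ∧
      (∀ t, t < T → A' t = A t) ∧ ∀ t, 0 ≤ t → t < T → τ' t = τ t := by
  have hlow := fun {t : ℝ} => hsol.neg_le_sub_delay hf_lip.continuous hpos hτ₀ (t := t)
  obtain ⟨hAc, hτc, hτ, hAφ, ⟨w, hw, hAw⟩, hthr⟩ := hsol
  have hf := hf_lip.continuous
  have hR0 : 0 < R := (norm_nonneg _).trans_lt hR
  have hτ₀R : ∀ x, τ₀ x < R := fun x =>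
    ((le_abs_self _).trans (τ₀.norm_coe_le_norm x)).trans_lt hR
  have hM0 : 0 ≤ M := (norm_nonneg _).trans (hM 0 ⟨by linarith, hT⟩)
  obtain ⟨A₀, hA₀, hA₀A, hconst, hA₀M⟩ :=
    hA.exists_lipschitzWith_of_Ico (by linarith : -R < T) hM
  obtain ⟨m, hm0, hm⟩ := exists_pos_le_of_antitone hf_mono hpos (M + 1)
  have hM2 : 0 < M + 1 + (T + 1 + R) := by positivity
  obtain ⟨C, hC⟩ := hF.exists_norm_le hM2
  obtain ⟨LF, hLF0, hLF⟩ := hF _ hM2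
  let c : C(X, ℝ) := ⟨fun x => ∫ s in (-(τ₀ x))..(0 : ℝ), f (A₀ s) x,
    (continuous_integral_apply (hf.comp hA₀.continuous)).comp
      (show Continuous fun x : X => (-(τ₀ x), (0 : ℝ), x) by fun_prop)⟩
  have hc0 : ∀ x, 0 ≤ c x := fun x =>
    intervalIntegral.integral_nonneg (by linarith [hτ₀ x]) fun s _ => (hpos _ x).le
  have hcφ : ∀ x, c x = ∫ s in (-(τ₀ x))..(0 : ℝ), f (φ s) x := fun x =>
    intervalIntegral.integral_congr fun s hs => by
      rw [uIcc_of_le (by linarith [hτ₀ x])] at hs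
      simp only [hA₀A s ⟨by linarith [hs.1, hτ₀R x], hs.2.trans_lt hT⟩, hAφ s hs.2]
  set S := extensionClass A₀ T (M + 1) (K + C)
  have hσex : ∀ B ∈ S, ∃ σ : ℝ → C(X, ℝ), Continuous σ ∧
      ∀ t x, σ t x ≤ t ∧ ∫ s in (σ t x)..t, f (B s) x = c x := fun B hB =>
    exists_continuous_threshold (hf.comp B.continuous) hm0 (fun s x => hm _ (hB.2.1 s) x) c hc0
  choose! σ hσc hσ using hσex
  have hσlow : ∀ B ∈ S, ∀ t, 0 ≤ t → ∀ x, -τ₀ x ≤ σ B t x := fun B hB t ht x => by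
    refine le_of_integral_eq_of_pos (g := fun s => f (B s) x) (by fun_prop)
      (fun s => hpos _ x) ht (((hσ B hB t x).2).trans ?_)
    refine intervalIntegral.integral_congr fun s hs => ?_
    rw [uIcc_of_le (by linarith [hτ₀ x])] at hs
    simp only [hB.2.2 s (hs.2.trans hT.le)]
  let N : (ℝ →ᵇ C(X, ℝ)) → ℝ → C(X, ℝ) := fun B l =>
    F (B l) (ContinuousMap.const X l - σ B l) (delayedEval B.toContinuousMap (σ B l))
  have hNc : ∀ B ∈ S, Continuous (N B) := fun B hB => by
    have h1 : Continuous fun l => ContinuousMap.const X l - σ B l :=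
      (ContinuousMap.continuous_const').sub (hσc B hB)
    exact hF.continuous.comp (B.continuous.prodMk
      (h1.prodMk ((continuous_delayedEval _).comp (hσc B hB))))
  have hbounds : ∀ B ∈ S, ∀ l ∈ Icc T (T + 1), ‖B l‖ ≤ M + 1 + (T + 1 + R) ∧
      ‖ContinuousMap.const X l - σ B l‖ ≤ M + 1 + (T + 1 + R) ∧
      ‖delayedEval B.toContinuousMap (σ B l)‖ ≤ M + 1 + (T + 1 + R) := fun B hB l hl => by
    have hMM : M + 1 ≤ M + 1 + (T + 1 + R) := le_add_of_nonneg_right (by positivity)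
    refine ⟨(hB.2.1 l).trans hMM, (ContinuousMap.norm_le _ hM2.le).2 fun x => ?_,
      (norm_delayedEval_le (by positivity) fun x => hB.2.1 _).trans hMM⟩
    rw [ContinuousMap.sub_apply, ContinuousMap.const_apply,
      Real.norm_of_nonneg (sub_nonneg.2 (hσ B hB l x).1)]
    linarith [hσlow B hB l (hT.le.trans hl.1) x, hτ₀R x, hl.2]
  have hNb : ∀ B ∈ S, ∀ l ∈ Icc T (T + 1), ‖N B l‖ ≤ C := fun B hB l hl =>
    hC _ _ _ (hbounds B hB l hl).1 (hbounds B hB l hl).2.1 (hbounds B hB l hl).2.2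
  set D : ℝ := Kf * (T + 1 + R) / m with hD
  have hD0 : 0 ≤ D := by positivity
  have hσL : ∀ B ∈ S, ∀ B' ∈ S, ∀ l ∈ Icc T (T + 1), ‖σ B l - σ B' l‖ ≤ D * ‖B - B'‖ := by
    intro B hB B' hB' l hl
    refine (ContinuousMap.norm_le _ (by positivity)).2 fun x => ?_
    have hBx : Continuous fun s => f (B s) x := by fun_prop
    have hBx' : Continuous fun s => f (B' s) x := by fun_prop
    have h1 := mul_abs_sub_le_abs_integral_sub hBx (fun s => hm _ (hB.2.1 s) x)
      (σ B l x) (σ B' l x) l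
    rw [(hσ B hB l x).2, ← (hσ B' hB' l x).2, ← intervalIntegral.integral_sub
      (hBx.intervalIntegrable _ _) (hBx'.intervalIntegrable _ _)] at h1
    have h2 : |∫ s in (σ B' l x)..l, (f (B s) x - f (B' s) x)| ≤
        Kf * ‖B - B'‖ * |l - σ B' l x| :=
      intervalIntegral.norm_integral_le_of_norm_le_const fun s _ =>
        ((f (B s) - f (B' s)).norm_coe_le_norm x).trans ((hf_lip.norm_sub_le _ _).trans
          (mul_le_mul_of_nonneg_left ((B - B').norm_coe_le_norm s) Kf.coe_nonneg))
    have h3 : |l - σ B' l x| ≤ T + 1 + R := by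
      rw [abs_of_nonneg (sub_nonneg.2 (hσ B' hB' l x).1)]
      linarith [hσlow B' hB' l (hT.le.trans hl.1) x, hτ₀R x, hl.2]
    have h4 : Kf * ‖B - B'‖ * |l - σ B' l x| ≤ Kf * ‖B - B'‖ * (T + 1 + R) :=
      mul_le_mul_of_nonneg_left h3 (by positivity)
    rw [ContinuousMap.sub_apply, Real.norm_eq_abs, hD, div_mul_eq_mul_div, le_div_iff₀ hm0]
    linarith
  let L : ℝ≥0 := ⟨LF * (1 + D + ((K + C) * D + 1)), by positivity⟩
  have hNL : ∀ B ∈ S, ∀ B' ∈ S, ∀ l ∈ Icc T (T + 1), ‖N B l - N B' l‖ ≤ L * ‖B - B'‖ := by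
    intro B hB B' hB' l hl
    obtain ⟨h1, h2, h3⟩ := hbounds B hB l hl
    obtain ⟨h4, h5, h6⟩ := hbounds B' hB' l hl
    refine (hLF _ _ _ _ _ _ h1 h2 h3 h4 h5 h6).trans ?_
    have e1 : ‖B l - B' l‖ ≤ ‖B - B'‖ := (B - B').norm_coe_le_norm l
    have e2 := hσL B hB B' hB' l hl
    have e3 := norm_delayedEval_sub_le (B := B.toContinuousMap) (B' := B'.toContinuousMap)
      (σ := σ B l) (σ' := σ B' l) hB.1 fun s => (B - B').norm_coe_le_norm s
    have e4 : ((K + C : ℝ≥0) : ℝ) * ‖σ B l - σ B' l‖ ≤ (K + C) * (D * ‖B - B'‖) := by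
      rw [NNReal.coe_add]
      exact mul_le_mul_of_nonneg_left e2 (by positivity)
    change _ ≤ LF * (1 + D + ((K + C) * D + 1)) * _
    rw [mul_assoc]
    refine mul_le_mul_of_nonneg_left ?_ hLF0.le
    rw [sub_sub_sub_cancel_left, norm_sub_rev (σ B' l)]
    linarith
  obtain ⟨h, hh0, B, hB, hBN⟩ := exists_local_extension hA₀ hconst hA₀M N hNc hNb hNL
  have hBA : ∀ t ∈ Ico (-R) T, B t = A t := fun t ht => by
    rw [hB.2.2 t ht.2.le, hA₀A t ht]
  have hBσ : ∀ t, 0 ≤ t → ∀ x, -R < σ B t x := fun t ht x => by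
    linarith [hσlow B hB t ht x, hτ₀R x]
  have hτσ : ∀ t, 0 ≤ t → t < T → τ t = ContinuousMap.const X t - σ B t := fun t ht htT => by
    ext x
    have hBx : Continuous fun s => f (B s) x := by fun_prop
    have h1 := mul_abs_sub_le_abs_integral_sub hBx (fun s => hm _ (hB.2.1 s) x)
      (σ B t x) (t - τ t x) t
    have h2 : ∫ s in (t - τ t x)..t, f (B s) x = c x := by
      rw [hcφ, ← hthr t ht (EReal.coe_lt_coe_iff.2 htT) x]
      refine intervalIntegral.integral_congr fun s hs => ?_
      rw [uIcc_of_le (by linarith [hτ t ht (EReal.coe_lt_coe_iff.2 htT) x])] at hs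
      simp only [hBA s ⟨by linarith [hlow ht htT x, hs.1, hτ₀R x], hs.2.trans_lt htT⟩]
    rw [h2, (hσ B hB t x).2, sub_self, abs_zero] at h1
    have h3 : |σ B t x - (t - τ t x)| = 0 :=
      le_antisymm (nonpos_of_mul_nonpos_right h1 hm0) (abs_nonneg _)
    simp only [ContinuousMap.sub_apply, ContinuousMap.const_apply]
    linarith [abs_eq_zero.1 h3]
  have hNx : ∀ x, Continuous fun l => N B l x := fun x => by
    have := hNc B hB
    fun_prop
  have hBint : ∀ x, ∀ t ∈ Icc 0 T, B t x = φ 0 x + ∫ l in (0 : ℝ)..t, N B l x := fun x => by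
    have hlt : EqOn (fun t => B t x) (fun t => φ 0 x + ∫ l in (0 : ℝ)..t, N B l x) (Ico 0 T) := by
      intro t ht
      simp only
      rw [hBA t ⟨by linarith [ht.1], ht.2⟩, hAw t ht.1 (EReal.coe_lt_coe_iff.2 ht.2) x]
      congr 1
      refine intervalIntegral.integral_congr fun l hl => ?_
      rw [uIcc_of_le ht.1] at hl
      have hlT := hl.2.trans_lt ht.2
      have hwl : w l = delayedEval B.toContinuousMap (σ B l) := by
        ext ⟨y, z⟩
        rw [hw l hl.1 (EReal.coe_lt_coe_iff.2 hlT), hτσ l hl.1 hlT]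
        simp only [ContinuousMap.sub_apply, ContinuousMap.const_apply, sub_sub_cancel,
          delayedEval_apply]
        exact congrArg (fun u : C(X, ℝ) => u z)
          (hBA _ ⟨(hBσ l hl.1 y).le, (hσ B hB l y).1.trans_lt hlT⟩).symm
      simp only [N, hwl, hτσ l hl.1 hlT, hBA l ⟨by linarith [hl.1], hlT⟩]
    have hcl := hlt.closure (by fun_prop) (continuous_const.add
      (intervalIntegral.continuous_primitive (fun _ _ => (hNx x).intervalIntegrable _ _) 0))
    rwa [closure_Ico hT.ne] at hcl
  have hBfull : ∀ x, ∀ t ∈ Ico 0 (T + h), B t x = φ 0 x + ∫ l in (0 : ℝ)..t, N B l x := by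
    intro x t ht
    rcases le_total t T with htT | hTt
    · exact hBint x t ⟨ht.1, htT⟩
    · have h1 : (∫ l in T..t, N B l) x = ∫ l in T..t, N B l x :=
        ((ContinuousMap.evalCLM ℝ x).intervalIntegral_comp_comm
          ((hNc B hB).intervalIntegrable T t)).symm
      rw [hBN t ⟨hTt, ht.2.le⟩, ContinuousMap.add_apply, h1, ← hB.2.2 T le_rfl,
        hBint x T ⟨hT.le, le_rfl⟩, add_assoc,
        intervalIntegral.integral_add_adjacent_intervals ((hNx x).intervalIntegrable _ _)
          ((hNx x).intervalIntegrable _ _)]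
  let A' : ℝ → C(X, ℝ) := fun t => if t < T then A t else B t
  let τ' : ℝ → C(X, ℝ) := fun t => if t < T then τ t else ContinuousMap.const X t - σ B t
  have hA'A : ∀ t, t < T → A' t = A t := fun t ht => if_pos ht
  have hA'B : ∀ t, -R ≤ t → A' t = B t := fun t ht => by
    by_cases htT : t < T
    · rw [hA'A t htT, hBA t ⟨ht, htT⟩]
    · exact if_neg htT
  have hτ'σ : ∀ t, 0 ≤ t → τ' t = ContinuousMap.const X t - σ B t := fun t ht => by
    by_cases htT : t < T
    · exact (if_pos htT).trans (hτσ t ht htT)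
    · exact if_neg htT
  refine ⟨T + h, by linarith, A', τ', ⟨?_, ?_, ?_, ?_, ⟨fun l =>
    delayedEval B.toContinuousMap (σ B l), ?_, ?_⟩, ?_⟩, hA'A, fun t _ ht => if_pos ht⟩
  · refine fun t _ => ContinuousAt.continuousWithinAt ?_
    by_cases htT : t < T
    · have hnhds : {s : ℝ | (s : EReal) < T} ∈ nhds t :=
        Filter.mem_of_superset (Iio_mem_nhds htT) fun s hs => EReal.coe_lt_coe_iff.2 hs
      exact (hAc.continuousAt hnhds).congr
        (Filter.mem_of_superset (Iio_mem_nhds htT) fun s hs => (hA'A s hs).symm)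
    · exact B.continuous.continuousAt.congr
        (Filter.mem_of_superset (Ioi_mem_nhds (show -R < t by linarith)) fun s hs =>
          (hA'B s (le_of_lt hs)).symm)
  · exact ((ContinuousMap.continuous_const').sub (hσc B hB)).continuousOn.congr
      fun t ht => hτ'σ t ht.1
  · intro t ht _ x
    rw [hτ'σ t ht]
    exact sub_nonneg.2 (hσ B hB t x).1
  · exact fun t ht => (hA'A t (ht.trans_lt hT)).trans (hAφ t ht)
  · intro l hl _ x y
    rw [hτ'σ l hl]
    simp only [ContinuousMap.sub_apply, ContinuousMap.const_apply, sub_sub_cancel,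
      delayedEval_apply]
    rw [hA'B _ (hBσ l hl x).le]
    rfl
  · intro t ht htT x
    rw [hA'B t (by linarith), hBfull x t ⟨ht, EReal.coe_lt_coe_iff.1 htT⟩]
    congr 1
    refine intervalIntegral.integral_congr fun l hl => ?_
    rw [uIcc_of_le ht] at hl
    simp only [N, hA'B l (by linarith [hl.1]), hτ'σ l hl.1]
  · intro t ht _ x
    rw [hτ'σ t ht, ← hcφ x, ← (hσ B hB t x).2]
    simp only [ContinuousMap.sub_apply, ContinuousMap.const_apply, sub_sub_cancel]
    refine intervalIntegral.integral_congr fun s hs => ?_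
    rw [uIcc_of_le (hσ B hB t x).1] at hs
    simp only [hA'B s ((hBσ t ht x).le.trans hs.1)]

end Continuation

/-- if (A,τ) solves (1.1) on [0,T) with T < +∞ and sup_{t∈[0,T)}‖A(t,·)‖_∞
is finite, then the solution is not maximal: it extends to a solution on [0,T′) for some
T′ > T, coinciding with (A,τ) on the original time interval. -/
theorem stmt_17
    {n : ℕ} (hn : 1 ≤ n)
    (Ω : Set (EuclideanSpace ℝ (Fin n))) (hΩ : IsCompact Ω) [CompactSpace Ω]
    (f : C(Ω, ℝ) → C(Ω, ℝ)) (Kf : ℝ≥0) (hf_lip : LipschitzWith Kf f)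
    (hf_mono : ∀ u v : C(Ω, ℝ), u ≤ v → f v ≤ f u)
    (Mbar : ℝ) (hMbar : 0 < Mbar)
    (hf_bdd : ∀ (ψ : C(Ω, ℝ)) (x : Ω), 0 < f ψ x ∧ f ψ x ≤ Mbar)
    (F : C(Ω, ℝ) → C(Ω, ℝ) → C(Ω × Ω, ℝ) → C(Ω, ℝ))
    (hF : LipschitzOnBoundedSets F)
    (α : ℝ) (hα : 0 ≤ α)
    (φ : ℝ → C(Ω, ℝ)) (hφ : MemLipAlpha α φ)
    (τ₀ : C(Ω, ℝ)) (hτ₀ : ∀ x, 0 ≤ τ₀ x)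
    (T : ℝ) (hT : 0 < T)
    (A τ : ℝ → C(Ω, ℝ)) (hsol : IsSolutionUpTo F f φ τ₀ (T : EReal) A τ)
    (M : ℝ) (hAbdd : ∀ t : ℝ, 0 ≤ t → t < T → ‖A t‖ ≤ M) :
    ∃ T' : ℝ, T < T' ∧ ∃ A' τ' : ℝ → C(Ω, ℝ),
      IsSolutionUpTo F f φ τ₀ (T' : EReal) A' τ' ∧
      (∀ t : ℝ, t < T → A' t = A t) ∧
      (∀ t : ℝ, 0 ≤ t → t < T → τ' t = τ t) := by
  have hpos : ∀ ψ x, 0 < f ψ x := fun ψ x => (hf_bdd ψ x).1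
  have hAφ : ∀ t ≤ (0 : ℝ), A t = φ t := hsol.2.2.2.1
  obtain ⟨Mφ, hMφ⟩ := isCompact_Icc.exists_bound_of_continuousOn
    (hφ.1.mono (Icc_subset_Iic_self : Icc (-(‖τ₀‖ + 1)) 0 ⊆ _))
  have hM : ∀ t ∈ Ico (-(‖τ₀‖ + 1)) T, ‖A t‖ ≤ max M Mφ := fun t ht => by
    rcases le_total t 0 with ht0 | ht0
    · rw [hAφ t ht0]
      exact (hMφ t ⟨ht.1, ht0⟩).trans (le_max_right _ _)
    · exact (hAbdd t ht0 ht.2).trans (le_max_left _ _)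
  obtain ⟨K, hK⟩ := hφ.exists_lipschitzOnWith_Icc hα (‖τ₀‖ + 1)
  have hKA : LipschitzOnWith K A (Icc (-(‖τ₀‖ + 1)) 0) := fun s hs t ht => by
    rw [hAφ s hs.2, hAφ t ht.2]
    exact hK hs ht
  obtain ⟨C, hC⟩ := hsol.exists_lipschitzOnWith hF hf_lip.continuous hpos hτ₀ hT
    fun t ht => hM t ⟨by linarith [ht.1], ht.2⟩
  exact hsol.exists_continuation hf_lip hf_mono hpos hF hτ₀ hT (lt_add_one ‖τ₀‖)
    (hKA.Icc_union_Ico hC) hM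
end

section
/- Fix τ₀ ∈ C_+(Ω). Then the set D_α := {φ ∈ BUC_α¹ : ∂_tφ(0,x) = F(φ(0,·), τ₀(·), (x,y) ↦ φ(−τ₀(x),y))(x) for all x ∈ Ω} is dense in BUC_α for the norm ‖·‖_{BUC_α}: for every ψ ∈ BUC_α and every ε > 0 there exists φ ∈ BUC_α¹ satisfying the compatibility condition ∂_tφ(0,x) = F(φ(0,·), τ₀(·), (x,y) ↦ φ(−τ₀(x),y))(x) for all x ∈ Ω and ‖φ − ψ‖_{BUC_α} < ε. -/
open scoped NNReal
open MeasureTheory intervalIntegral Set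

/-- Membership in `BUC_α`: `φ_α` is bounded and uniformly continuous from `(−∞,0]` to `C(Ω)`. -/
def MemBUCAlpha {Ω : Type*} [TopologicalSpace Ω] [CompactSpace Ω]
    (α : ℝ) (φ : ℝ → C(Ω, ℝ)) : Prop :=
  ContinuousOn φ (Set.Iic 0) ∧
  (∃ C : ℝ, ∀ t ≤ (0 : ℝ), ‖weightedHist α φ t‖ ≤ C) ∧
  UniformContinuousOn (weightedHist α φ) (Set.Iic 0)

/-- Membership in `BUC_α¹`: `φ` is continuously differentiable on `(−∞,0]` with derivative
`φ'`, and both `φ_α` and `(∂ₜφ)_α` are bounded and uniformly continuous. -/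
def MemBUCAlphaOne {Ω : Type*} [TopologicalSpace Ω] [CompactSpace Ω]
    (α : ℝ) (φ φ' : ℝ → C(Ω, ℝ)) : Prop :=
  (∀ t ≤ (0 : ℝ), HasDerivWithinAt φ (φ' t) (Set.Iic 0) t) ∧
  ContinuousOn φ' (Set.Iic 0) ∧
  MemBUCAlpha α φ ∧ MemBUCAlpha α φ'

/-- A bounded uniformly continuous function on `ℝ` is uniformly approximated by
differentiable functions which are bounded and uniformly continuous with their derivative. -/
theorem exists_smooth_approx {E : Type*} [NormedAddCommGroup E] [NormedSpace ℝ E]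
    [CompleteSpace E] (G : ℝ → E) (hG : UniformContinuous G) (C : ℝ) (hC : ∀ t, ‖G t‖ ≤ C)
    (ε : ℝ) (hε : 0 < ε) :
    ∃ S S' : ℝ → E, (∀ t, HasDerivAt S (S' t) t) ∧ UniformContinuous S ∧
      UniformContinuous S' ∧ (∃ B, ∀ t, ‖S t‖ ≤ B) ∧ (∃ B, ∀ t, ‖S' t‖ ≤ B) ∧
      ∀ t, ‖S t - G t‖ ≤ ε := by
  obtain ⟨δ, hδ, hGδ⟩ := Metric.uniformContinuous_iff.1 hG ε hε
  set h : ℝ := δ / 2 with hh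
  have hh0 : 0 < h := by positivity
  have hint : ∀ a b, IntervalIntegrable G volume a b := fun a b =>
    hG.continuous.intervalIntegrable a b
  have hP : ∀ t, HasDerivAt (fun t => ∫ s in (0 : ℝ)..t, G s) (G t) t := fun t =>
    hG.continuous.integral_hasStrictDerivAt 0 t |>.hasDerivAt
  have hS : ∀ t, HasDerivAt
      (fun t => h⁻¹ • ((∫ s in (0 : ℝ)..(t + h), G s) - ∫ s in (0 : ℝ)..t, G s))
      (h⁻¹ • (G (t + h) - G t)) t := fun t =>
    (((hP (t + h)).comp_add_const t h).sub (hP t)).const_smul h⁻¹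
  have hS'B : ∀ t, ‖h⁻¹ • (G (t + h) - G t)‖ ≤ h⁻¹ * (C + C) := by
    intro t
    rw [norm_smul, Real.norm_of_nonneg (by positivity)]
    gcongr
    exact (norm_sub_le _ _).trans (add_le_add (hC _) (hC _))
  have hSG : ∀ t,
      ‖h⁻¹ • ((∫ s in (0 : ℝ)..(t + h), G s) - ∫ s in (0 : ℝ)..t, G s) - G t‖ ≤ ε := by
    intro t
    have h1 : h⁻¹ • ((∫ s in (0 : ℝ)..(t + h), G s) - ∫ s in (0 : ℝ)..t, G s) - G t
        = h⁻¹ • ∫ s in t..(t + h), (G s - G t) := by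
      rw [integral_interval_sub_left (hint _ _) (hint _ _),
        intervalIntegral.integral_sub (hint _ _) (by simp),
        intervalIntegral.integral_const, smul_sub, smul_smul]
      simp [hh0.ne']
    have h2 : ‖∫ s in t..(t + h), (G s - G t)‖ ≤ ε * |t + h - t| := by
      apply intervalIntegral.norm_integral_le_of_norm_le_const
      intro s hs
      rw [uIoc_of_le (by linarith)] at hs
      rw [← dist_eq_norm]
      refine (hGδ ?_).le
      rw [Real.dist_eq, abs_lt]
      constructor <;> linarith [hs.1, hs.2]
    rw [h1, norm_smul, Real.norm_of_nonneg (by positivity)]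
    rw [add_sub_cancel_left, abs_of_pos hh0] at h2
    rw [inv_mul_le_iff₀ hh0]
    linarith
  refine ⟨_, _, hS, ?_, ?_, ⟨ε + C, fun t => ?_⟩, ⟨_, hS'B⟩, hSG⟩
  · have hB0 : 0 ≤ h⁻¹ * (C + C) := (norm_nonneg _).trans (hS'B 0)
    refine (lipschitzWith_of_nnnorm_deriv_le (C := ⟨h⁻¹ * (C + C), hB0⟩)
      (fun t => (hS t).differentiableAt) fun t => ?_).uniformContinuous
    rw [(hS t).deriv]
    exact hS'B t
  · exact ((hG.comp (uniformContinuous_id.add uniformContinuous_const)).sub hG).const_smul h⁻¹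
  · exact (norm_le_norm_sub_add _ (G t)).trans (add_le_add (hSG t) (hC t))

/-- A half-contraction of a closed ball which moves the centre by at most half the radius
has a fixed point. -/
theorem exists_fixedPoint_of_half_contraction {E : Type*} [NormedAddCommGroup E]
    [CompleteSpace E] (Φ : E → E) (R : ℝ) (hR : ‖Φ 0‖ ≤ R / 2)
    (hΦ : ∀ u v, ‖u‖ ≤ R → ‖v‖ ≤ R → ‖Φ u - Φ v‖ ≤ 1 / 2 * ‖u - v‖) :
    ∃ v, ‖v‖ ≤ R ∧ Φ v = v := by
  have hR0 : 0 ≤ R := by linarith [norm_nonneg (Φ 0)]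
  have hmaps : MapsTo Φ (Metric.closedBall 0 R) (Metric.closedBall 0 R) := by
    intro v hv
    rw [mem_closedBall_zero_iff] at hv ⊢
    have h1 := hΦ v 0 hv (by simpa using hR0)
    rw [sub_zero] at h1
    linarith [norm_le_norm_sub_add (Φ v) (Φ 0)]
  have hcon : ContractingWith (1 / 2 : ℝ≥0) (hmaps.restrict Φ _ _) := by
    refine ⟨by rw [← NNReal.coe_lt_coe]; norm_num, LipschitzWith.of_dist_le_mul fun u v => ?_⟩
    have h1 := hΦ u v (mem_closedBall_zero_iff.1 u.2) (mem_closedBall_zero_iff.1 v.2)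
    rw [Subtype.dist_eq, Subtype.dist_eq, dist_eq_norm, dist_eq_norm]
    simpa using h1
  obtain ⟨v, hv, hfix, -⟩ := hcon.exists_fixedPoint' Metric.isClosed_closedBall.isComplete hmaps
    (Metric.mem_closedBall_self hR0) (edist_ne_top _ _)
  exact ⟨v, mem_closedBall_zero_iff.1 hv, hfix⟩

theorem weightedHist_exp_smul {Ω : Type*} [TopologicalSpace Ω] (α : ℝ) (S : ℝ → C(Ω, ℝ))
    {t : ℝ} (ht : t ≤ 0) :
    weightedHist α (fun t => Real.exp (-(α * t)) • S t) t = S t := by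
  simp only [weightedHist]
  rw [smul_smul, ← Real.exp_add, abs_of_nonpos ht]
  simp

theorem memBUCAlpha_exp_smul {Ω : Type*} [TopologicalSpace Ω] [CompactSpace Ω] (α : ℝ)
    {S : ℝ → C(Ω, ℝ)} (hS : UniformContinuous S) (hB : ∃ B, ∀ t, ‖S t‖ ≤ B) :
    MemBUCAlpha α (fun t => Real.exp (-(α * t)) • S t) := by
  obtain ⟨B, hB⟩ := hB
  refine ⟨?_, ⟨B, fun t ht => ?_⟩, ?_⟩
  · have := hS.continuous
    exact Continuous.continuousOn (by fun_prop)
  · rw [weightedHist_exp_smul α S ht]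
    exact hB t
  · exact hS.uniformContinuousOn.congr fun t ht => (weightedHist_exp_smul α S ht).symm

theorem memBUCAlphaOne_exp_smul {Ω : Type*} [TopologicalSpace Ω] [CompactSpace Ω] (α : ℝ)
    {S S' : ℝ → C(Ω, ℝ)} (hd : ∀ t, HasDerivAt S (S' t) t) (hS : UniformContinuous S)
    (hS' : UniformContinuous S') (hB : ∃ B, ∀ t, ‖S t‖ ≤ B) (hB' : ∃ B, ∀ t, ‖S' t‖ ≤ B) :
    MemBUCAlphaOne α (fun t => Real.exp (-(α * t)) • S t)
      (fun t => Real.exp (-(α * t)) • (S' t - α • S t)) := by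
  have hmem : MemBUCAlpha α (fun t => Real.exp (-(α * t)) • (S' t - α • S t)) := by
    refine memBUCAlpha_exp_smul α (hS'.sub (hS.const_smul α)) ?_
    obtain ⟨B, hB⟩ := hB
    obtain ⟨B', hB'⟩ := hB'
    refine ⟨B' + |α| * B, fun t => (norm_sub_le _ _).trans (add_le_add (hB' t) ?_)⟩
    rw [norm_smul, Real.norm_eq_abs]
    exact mul_le_mul_of_nonneg_left (hB t) (abs_nonneg α)
  refine ⟨fun t _ => ?_, hmem.1, memBUCAlpha_exp_smul α hS hB, hmem⟩
  have he : HasDerivAt (fun t => Real.exp (-(α * t))) (Real.exp (-(α * t)) * -(α * 1)) t :=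
    ((hasDerivAt_id t).const_mul α).neg.exp
  refine ((he.smul (hd t)).congr_deriv ?_).hasDerivWithinAt
  module

/-- The continuous function `(x, y) ↦ φ (-τ x) y`. -/
def delayedHist {Ω : Type*} [TopologicalSpace Ω] [CompactSpace Ω] (φ : ℝ → C(Ω, ℝ))
    (hφ : Continuous φ) (τ : C(Ω, ℝ)) : C(Ω × Ω, ℝ) where
  toFun p := φ (-(τ p.1)) p.2
  continuous_toFun := by fun_prop

/-- The continuous function `(x, y) ↦ c x * v y`. -/
def tensorMap {Ω : Type*} [TopologicalSpace Ω] (c v : C(Ω, ℝ)) : C(Ω × Ω, ℝ) where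
  toFun p := c p.1 * v p.2
  continuous_toFun := by fun_prop

theorem norm_tensorMap_sub_le {Ω : Type*} [TopologicalSpace Ω] [CompactSpace Ω]
    (c u v : C(Ω, ℝ)) : ‖tensorMap c u - tensorMap c v‖ ≤ ‖c‖ * ‖u - v‖ := by
  rw [ContinuousMap.norm_le _ (by positivity)]
  rintro ⟨x, y⟩
  have h1 : (tensorMap c u - tensorMap c v) (x, y) = c x * (u - v) y := by
    simp [tensorMap, mul_sub]
  rw [h1, norm_mul]
  gcongr
  · exact c.norm_coe_le_norm x
  · exact (u - v).norm_coe_le_norm y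

theorem tensorMap_zero {Ω : Type*} [TopologicalSpace Ω] (c : C(Ω, ℝ)) :
    tensorMap c 0 = 0 := by
  ext p
  simp [tensorMap]

/-- The perturbation `t ↦ k⁻¹ sin (k t) v` has derivative `v` at `0` and is `O(k⁻¹)`. -/
theorem hasDerivAt_sin_smul {E : Type*} [NormedAddCommGroup E] [NormedSpace ℝ E] {k : ℝ}
    (hk : k ≠ 0) (v : E) (t : ℝ) :
    HasDerivAt (fun t => (k⁻¹ * Real.sin (k * t)) • v) (Real.cos (k * t) • v) t := by
  have h1 : HasDerivAt (fun t => k⁻¹ * Real.sin (k * t)) (k⁻¹ * (Real.cos (k * t) * (k * 1))) t :=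
    (((hasDerivAt_id t).const_mul k).sin).const_mul k⁻¹
  refine (h1.smul_const v).congr_deriv ?_
  congr 1
  field_simp

theorem UniformContinuous.smul_const_vector {E : Type*} [NormedAddCommGroup E]
    [NormedSpace ℝ E] {f : ℝ → ℝ} (hf : UniformContinuous f) (v : E) :
    UniformContinuous fun t => f t • v :=
  (ContinuousLinearMap.toSpanSingleton ℝ v).uniformContinuous.comp hf

/-- for fixed τ₀ ∈ C₊(Ω), the set D_α of histories φ ∈ BUC_α¹ satisfying the
compatibility condition ∂ₜφ(0,x) = F(φ(0,·), τ₀(·), (x,y) ↦ φ(−τ₀(x),y))(x) is dense in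
BUC_α: every ψ ∈ BUC_α can be approximated to within any ε > 0 in the BUC_α-norm by an
element of D_α. -/
theorem stmt_18
    {n : ℕ} (hn : 1 ≤ n)
    (Ω : Set (EuclideanSpace ℝ (Fin n))) (hΩ : IsCompact Ω) [CompactSpace Ω]
    (F : C(Ω, ℝ) → C(Ω, ℝ) → C(Ω × Ω, ℝ) → C(Ω, ℝ))
    (hF : ∀ M : ℝ, 0 < M → ∃ L : ℝ, 0 < L ∧
      ∀ u v : C(Ω, ℝ), ∀ w : C(Ω × Ω, ℝ), ∀ u' v' : C(Ω, ℝ), ∀ w' : C(Ω × Ω, ℝ),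
        ‖u‖ ≤ M → ‖v‖ ≤ M → ‖w‖ ≤ M → ‖u'‖ ≤ M → ‖v'‖ ≤ M → ‖w'‖ ≤ M →
        ‖F u v w - F u' v' w'‖ ≤ L * (‖u - u'‖ + ‖v - v'‖ + ‖w - w'‖))
    (α : ℝ) (hα : 0 ≤ α)
    (τ₀ : C(Ω, ℝ)) (hτ₀ : ∀ x, 0 ≤ τ₀ x) :
    ∀ ψ : ℝ → C(Ω, ℝ), MemBUCAlpha α ψ → ∀ ε : ℝ, 0 < ε →
      ∃ φ φ' : ℝ → C(Ω, ℝ),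
        MemBUCAlphaOne α φ φ' ∧
        (∃ w : C(Ω × Ω, ℝ), (∀ x y : Ω, w (x, y) = φ (-(τ₀ x)) y) ∧
          φ' 0 = F (φ 0) τ₀ w) ∧
        sSup {c : ℝ | ∃ t ≤ (0 : ℝ), c = ‖weightedHist α φ t - weightedHist α ψ t‖} < ε := by
  intro ψ hψ ε hε
  obtain ⟨-, ⟨C, hC⟩, hψu⟩ := hψ
  have hGu : UniformContinuous fun t : ℝ => weightedHist α ψ (min t 0) := by
    rw [← uniformContinuousOn_univ]
    refine hψu.comp (f := fun t : ℝ => min t 0) ?_ fun t _ => min_le_right t 0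
    exact (LipschitzWith.id.min_const 0).uniformContinuous.uniformContinuousOn
  obtain ⟨S, S', hd, hS, hS', ⟨B, hB⟩, ⟨B', hB'⟩, hSG⟩ := exists_smooth_approx _ hGu C
    (fun t => hC _ (min_le_right t 0)) (ε / 4) (by positivity)
  have hSc := hS.continuous
  set w₁ : C(Ω × Ω, ℝ) := delayedHist (fun t => Real.exp (-(α * t)) • S t) (by fun_prop) τ₀
    with hw₁
  set R : ℝ := 2 * ‖F (S 0) τ₀ w₁ - (S' 0 - α • S 0)‖ + 1 with hR
  have hR0 : 0 < R := by positivity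
  obtain ⟨L, hL, hFL⟩ := hF (‖S 0‖ + ‖τ₀‖ + ‖w₁‖ + R) (by positivity)
  set A : ℝ := Real.exp (α * ‖τ₀‖)
  have hA0 : 0 < A := Real.exp_pos _
  set k : ℝ := A + 2 * (L * A) + 4 * R / ε with hk
  have hk0 : 0 < k := by positivity
  have hkA : A ≤ k := by
    have : 0 ≤ 2 * (L * A) + 4 * R / ε := by positivity
    linarith
  have hkL : 2 * (L * A) ≤ k := by
    have : 0 ≤ A + 4 * R / ε := by positivity
    linarith
  have hkR : 4 * R / ε ≤ k := by
    have : 0 ≤ A + 2 * (L * A) := by positivity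
    linarith
  set c : C(Ω, ℝ) := ⟨fun x => Real.exp (α * τ₀ x) * (k⁻¹ * Real.sin (k * -(τ₀ x))),
    by fun_prop⟩ with hc
  have hcn : ‖c‖ ≤ A * k⁻¹ := by
    rw [ContinuousMap.norm_le _ (by positivity)]
    intro x
    have h1 : τ₀ x ≤ ‖τ₀‖ := (le_abs_self _).trans (τ₀.norm_coe_le_norm x)
    change ‖Real.exp (α * τ₀ x) * (k⁻¹ * Real.sin (k * -(τ₀ x)))‖ ≤ _
    rw [norm_mul, norm_mul, Real.norm_of_nonneg (Real.exp_pos _).le,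
      Real.norm_of_nonneg (inv_pos.2 hk0).le]
    have h2 : ‖Real.sin (k * -(τ₀ x))‖ ≤ 1 := Real.abs_sin_le_one _
    have h3 : Real.exp (α * τ₀ x) ≤ A :=
      Real.exp_le_exp.2 (mul_le_mul_of_nonneg_left h1 hα)
    have h4 : k⁻¹ * ‖Real.sin (k * -(τ₀ x))‖ ≤ k⁻¹ :=
      mul_le_of_le_one_right (inv_pos.2 hk0).le h2
    exact mul_le_mul h3 h4 (by positivity) hA0.le
  have hc1 : ‖c‖ ≤ 1 := hcn.trans (by rwa [← div_eq_mul_inv, div_le_one hk0])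
  have hcL : L * ‖c‖ ≤ 1 / 2 := by
    refine (mul_le_mul_of_nonneg_left hcn hL.le).trans ?_
    rw [← mul_assoc, ← div_eq_mul_inv, div_le_iff₀ hk0]
    linarith
  have hwn : ∀ v : C(Ω, ℝ), ‖v‖ ≤ R →
      ‖w₁ + tensorMap c v‖ ≤ ‖S 0‖ + ‖τ₀‖ + ‖w₁‖ + R := by
    intro v hv
    have h1 := norm_tensorMap_sub_le c v 0
    rw [tensorMap_zero, sub_zero, sub_zero] at h1
    have h2 : ‖c‖ * ‖v‖ ≤ 1 * R := mul_le_mul hc1 hv (norm_nonneg _) zero_le_one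
    linarith [norm_add_le w₁ (tensorMap c v), norm_nonneg (S 0), norm_nonneg τ₀]
  obtain ⟨v, hvR, hv⟩ := exists_fixedPoint_of_half_contraction
    (fun v => F (S 0) τ₀ (w₁ + tensorMap c v) - (S' 0 - α • S 0)) R
    (by simp only [tensorMap_zero, add_zero]; linarith)
    (by
      intro u v hu hv
      have hS0 : ‖S 0‖ ≤ ‖S 0‖ + ‖τ₀‖ + ‖w₁‖ + R := by
        linarith [norm_nonneg τ₀, norm_nonneg w₁]
      have hτn : ‖τ₀‖ ≤ ‖S 0‖ + ‖τ₀‖ + ‖w₁‖ + R := by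
        linarith [norm_nonneg (S 0), norm_nonneg w₁]
      have h1 := hFL (S 0) τ₀ (w₁ + tensorMap c u) (S 0) τ₀ (w₁ + tensorMap c v)
        hS0 hτn (hwn u hu) hS0 hτn (hwn v hv)
      simp only [sub_self, norm_zero, zero_add, add_sub_add_left_eq_sub] at h1
      rw [sub_sub_sub_cancel_right]
      calc _ ≤ L * (‖c‖ * ‖u - v‖) :=
            h1.trans (mul_le_mul_of_nonneg_left (norm_tensorMap_sub_le c u v) hL.le)
        _ = L * ‖c‖ * ‖u - v‖ := by ring
        _ ≤ 1 / 2 * ‖u - v‖ := mul_le_mul_of_nonneg_right hcL (norm_nonneg _))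
  have hkt : UniformContinuous fun t : ℝ => k * t := uniformContinuous_id.const_smul k
  have hsin : UniformContinuous fun t => (k⁻¹ * Real.sin (k * t)) • v :=
    UniformContinuous.smul_const_vector
      ((Real.lipschitzWith_sin.uniformContinuous.comp hkt).const_smul k⁻¹) v
  have hcos : UniformContinuous fun t => Real.cos (k * t) • v :=
    UniformContinuous.smul_const_vector (Real.lipschitzWith_cos.uniformContinuous.comp hkt) v
  have hsinB : ∀ t, ‖(k⁻¹ * Real.sin (k * t)) • v‖ ≤ ε / 4 := by
    intro t
    rw [norm_smul, norm_mul, Real.norm_of_nonneg (inv_pos.2 hk0).le]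
    have h2 : ‖Real.sin (k * t)‖ ≤ 1 := Real.abs_sin_le_one _
    have h4 : k⁻¹ * ‖Real.sin (k * t)‖ ≤ k⁻¹ := mul_le_of_le_one_right (inv_pos.2 hk0).le h2
    refine (mul_le_mul h4 hvR (norm_nonneg _) (inv_pos.2 hk0).le).trans ?_
    rw [inv_mul_le_iff₀ hk0]
    rw [div_le_iff₀ hε] at hkR
    linarith
  have hcosB : ∀ t, ‖Real.cos (k * t) • v‖ ≤ ‖v‖ := by
    intro t
    rw [norm_smul]
    exact mul_le_of_le_one_left (norm_nonneg _) (Real.abs_cos_le_one _)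
  refine ⟨_, _, memBUCAlphaOne_exp_smul α
    (fun t => (hd t).add (hasDerivAt_sin_smul hk0.ne' v t)) (hS.add hsin) (hS'.add hcos)
    ⟨B + ε / 4, fun t => (norm_add_le _ _).trans (add_le_add (hB t) (hsinB t))⟩
    ⟨B' + ‖v‖, fun t => (norm_add_le _ _).trans (add_le_add (hB' t) (hcosB t))⟩,
    ⟨w₁ + tensorMap c v, fun x y => ?_, ?_⟩, ?_⟩
  · simp only [hw₁, hc, delayedHist, tensorMap, ContinuousMap.add_apply, ContinuousMap.coe_mk,
      ContinuousMap.smul_apply, Pi.add_apply, smul_eq_mul, mul_neg, neg_neg]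
    ring
  · have h0 : F (S 0) τ₀ (w₁ + tensorMap c v) = v + (S' 0 - α • S 0) := sub_eq_iff_eq_add.1 hv
    simp only [Pi.add_apply, mul_zero, neg_zero, Real.exp_zero, one_smul, Real.sin_zero, zero_smul,
      add_zero, Real.cos_zero, h0]
    abel
  · refine lt_of_le_of_lt (csSup_le ⟨_, 0, le_rfl, rfl⟩ ?_) (by linarith : ε / 2 < ε)
    rintro _ ⟨t, ht, rfl⟩
    rw [weightedHist_exp_smul α _ ht]
    have h1 := hSG t
    rw [min_eq_left ht] at h1
    have h2 : (S + fun t => (k⁻¹ * Real.sin (k * t)) • v) t - weightedHist α ψ t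
        = (S t - weightedHist α ψ t) + (k⁻¹ * Real.sin (k * t)) • v := by
      simp only [Pi.add_apply]
      abel
    rw [h2]
    linarith [norm_add_le (S t - weightedHist α ψ t) ((k⁻¹ * Real.sin (k * t)) • v), hsinB t]
end
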